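/- Let γ ∈ (−3,−2), let k > (γ+3)/2 and set m(v) = ⟨v⟩^k; let α satisfy 0 ≤ α < k − (γ+3)/2 and set ω(v) = ⟨v⟩^α. Let χ : ℝ³ → [0,1] be a smooth function with χ(v) = 1 for |v| ≤ 1 and χ(v) = 0 for |v| > 2, and set χ_R(v) = χ(v/R). Then there exist constants M, R, C > 0 such that for every Schwartz function φ on ℝ³, with B*_m φ := Σ_{i,j} ā_{ij} ∂_{ij}φ + Σ_j ( 2 Σ_i ā_{ij} ∂_i m/m + 2 b̄_j ) ∂_j φ + ( Σ_{i,j} ā_{ij} ∂_{ij}m/m + 2 Σ_i b̄_i ∂_i m/m − M χ_R ) φ, one has ∫_{ℝ³} (B*_m φ)(v) φ(v) ω(v)² dv ≤ −C ( ∫_{ℝ³} ⟨v⟩^γ φ(v)² ω(v)² dv + ∫_{ℝ³} ⟨v⟩^γ |∇̃φ(v)|² ω(v)² dv ). -/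

import Mathlib

noncomputable section

open MeasureTheory Real Filter

abbrev V3 := EuclideanSpace ℝ (Fin 3)

/-- Japanese bracket ⟨v⟩ = (1+|v|²)^{1/2}. -/
def jap (v : V3) : ℝ := Real.sqrt (1 + ‖v‖ ^ 2)

/-- Standard Gaussian μ on ℝ³. -/
def gaussM (v : V3) : ℝ := (2 * Real.pi) ^ (-(3 : ℝ) / 2) * Real.exp (-‖v‖ ^ 2 / 2)

/-- Landau kernel matrix a_{ij}(z). -/
def aker (γ : ℝ) (z : V3) (i j : Fin 3) : ℝ :=
  ‖z‖ ^ (γ + 2) * ((if i = j then (1 : ℝ) else 0) - z i * z j / ‖z‖ ^ 2)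

/-- ā_{ij} = a_{ij} * μ. -/
def abar (γ : ℝ) (v : V3) (i j : Fin 3) : ℝ := ∫ w : V3, aker γ (v - w) i j * gaussM w

def bker (γ : ℝ) (z : V3) (i : Fin 3) : ℝ := -2 * ‖z‖ ^ γ * z i

/-- b̄_i = b_i * μ. -/
def bbar (γ : ℝ) (v : V3) (i : Fin 3) : ℝ := ∫ w : V3, bker γ (v - w) i * gaussM w

/-- J_β(v) = ∫ |v−w|^β μ(w) dw. -/
def Jfun (β : ℝ) (v : V3) : ℝ := ∫ w : V3, ‖v - w‖ ^ β * gaussM w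

/-- c̄(v) = −2(γ+3) J_γ(v). -/
def cbar (γ : ℝ) (v : V3) : ℝ := -2 * (γ + 3) * Jfun γ v

/-- ℓ₁(v). -/
def ell1 (γ : ℝ) (v : V3) : ℝ :=
  ∫ w : V3, (1 - ((∑ i, v i * w i) / (‖v‖ * ‖w‖)) ^ 2) * ‖w‖ ^ (γ + 2) * gaussM (v - w)

/-- Squared Euclidean norm of the cross product of two vectors in ℝ³. -/
def crossSq (a b : V3) : ℝ :=
  ∑ i, (crossProduct (R := ℝ) (fun k => a k) (fun k => b k) i) ^ 2

/-- ℓ₂(v). -/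
def ell2 (γ : ℝ) (v : V3) : ℝ :=
  ∫ w : V3,
    (1 - (1 / 2) * crossSq (‖v‖⁻¹ • v) (‖w‖⁻¹ • w)) * ‖w‖ ^ (γ + 2) * gaussM (v - w)

/-- Projection P_v ξ on the direction v. -/
def Pv (v ξ : V3) : V3 := ((∑ i, ξ i * v i) / ‖v‖ ^ 2) • v

/-- Partial derivative in the i-th coordinate direction. -/
def pd (i : Fin 3) (f : V3 → ℝ) : V3 → ℝ := fun v => fderiv ℝ f v (EuclideanSpace.single i 1)

/-- Anisotropic gradient ∇̃f = P_v ∇f + ⟨v⟩ (I − P_v) ∇f. -/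
def anisoGrad (f : V3 → ℝ) (v : V3) : V3 :=
  Pv v (gradient f v) + jap v • (gradient f v - Pv v (gradient f v))

/-- The filter |v| → ∞ on ℝ³. -/
def normAtTop : Filter V3 := Filter.comap (fun v : V3 => ‖v‖) Filter.atTop

/-- ζ_m(v) = Σ ā_{ij} ∂_{ij}m/m + Σ ā_{ij} (∂_i m/m)(∂_j m/m) + 2 Σ b̄_i ∂_i m/m − c̄/2. -/
def zeta (γ : ℝ) (m : V3 → ℝ) (v : V3) : ℝ :=
  (∑ i, ∑ j, abar γ v i j * pd i (pd j m) v / m v)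
  + (∑ i, ∑ j, abar γ v i j * (pd i m v / m v) * (pd j m v / m v))
  + 2 * (∑ i, bbar γ v i * pd i m v / m v)
  - cbar γ v / 2

/-- ζ̃_m(v) = Σ ā_{ij} (∂_i m/m)(∂_j m/m) + Σ b̄_i ∂_i m/m − c̄/2. -/
def zetaT (γ : ℝ) (m : V3 → ℝ) (v : V3) : ℝ :=
  (∑ i, ∑ j, abar γ v i j * (pd i m v / m v) * (pd j m v / m v))
  + (∑ i, bbar γ v i * pd i m v / m v)
  - cbar γ v / 2

/-- ζ_{m,ω}(v). -/
def zetaMW (γ : ℝ) (m ω : V3 → ℝ) (v : V3) : ℝ :=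
  (∑ i, ∑ j, abar γ v i j * pd i (pd j ω) v / ω v)
  + (∑ i, ∑ j, abar γ v i j * (pd i ω v / ω v) * (pd j ω v / ω v))
  - 2 * (∑ i, ∑ j, abar γ v i j * (pd i ω v / ω v) * (pd j m v / m v))

/-- The formal adjoint B*_m φ (with cutoff Mχ_R). -/
def BstarOp (γ : ℝ) (m : V3 → ℝ) (M R : ℝ) (χ : V3 → ℝ) (φ : V3 → ℝ) (v : V3) : ℝ :=
  (∑ i, ∑ j, abar γ v i j * pd i (pd j φ) v)
  + (∑ j, (2 * (∑ i, abar γ v i j * pd i m v / m v) + 2 * bbar γ v j) * pd j φ v)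
  + ((∑ i, ∑ j, abar γ v i j * pd i (pd j m) v / m v)
      + 2 * (∑ i, bbar γ v i * pd i m v / m v) - M * χ (R⁻¹ • v)) * φ v

lemma jap_sq (v : V3) : jap v ^ 2 = 1 + ‖v‖ ^ 2 := by
  unfold jap; rw [Real.sq_sqrt]; positivity

lemma one_le_jap (v : V3) : 1 ≤ jap v := by
  unfold jap; rw [Real.one_le_sqrt]; nlinarith [sq_nonneg ‖v‖]

lemma jap_pos (v : V3) : 0 < jap v := lt_of_lt_of_le one_pos (one_le_jap v)

lemma norm_le_jap (v : V3) : ‖v‖ ≤ jap v := by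
  unfold jap; apply Real.le_sqrt_of_sq_le; linarith

lemma continuous_jap : Continuous jap := by
  unfold jap; fun_prop

lemma continuous_jap_rpow (s : ℝ) : Continuous (fun v => jap v ^ s) :=
  continuous_jap.rpow_const fun v => Or.inl (jap_pos v).ne'

lemma jap_rpow_eq (s : ℝ) (v : V3) : jap v ^ s = (1 + ‖v‖ ^ 2) ^ (s / 2) := by
  unfold jap
  rw [Real.sqrt_eq_rpow, ← Real.rpow_mul (by positivity)]
  ring_nf

/-- Peetre's inequality. -/
lemma jap_le_mul_jap_sub (v w : V3) : jap v ≤ 2 * jap (v - w) * jap w := by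
  have h1 : ‖v‖ ≤ ‖v - w‖ + ‖w‖ := by simpa using norm_add_le (v - w) w
  have := jap_sq v
  have := jap_sq (v - w)
  have := jap_sq w
  apply le_of_sq_le_sq _ (by have := jap_pos (v - w); have := jap_pos w; positivity)
  rw [mul_pow, mul_pow, jap_sq, jap_sq, jap_sq]
  have h2 : ‖v‖ ^ 2 ≤ (‖v - w‖ + ‖w‖) ^ 2 := by gcongr
  nlinarith [sq_nonneg (‖v - w‖ - ‖w‖), sq_nonneg (‖v - w‖ * ‖w‖), sq_nonneg ‖v - w‖, sq_nonneg ‖w‖]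

lemma norm_sub_le_mul_jap (v w : V3) : ‖v - w‖ ≤ 2 * jap v * jap w := by
  have h1 : ‖v - w‖ ≤ ‖v‖ + ‖w‖ := norm_sub_le v w
  nlinarith [norm_le_jap v, norm_le_jap w, one_le_jap v, one_le_jap w]

/-- The majorant of all the kernels of this file. -/
def kap (γ : ℝ) (z : V3) : ℝ := 1 + ‖z‖ ^ γ

lemma one_le_kap (γ : ℝ) (z : V3) : 1 ≤ kap γ z := by
  unfold kap; have := Real.rpow_nonneg (norm_nonneg z) γ; linarith

lemma kap_nonneg (γ : ℝ) (z : V3) : 0 ≤ kap γ z := zero_le_one.trans (one_le_kap γ z)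

lemma measurable_kap (γ : ℝ) : Measurable (kap γ) := by
  unfold kap; fun_prop

lemma norm_rpow_le_max_mul_kap {γ β : ℝ} (h1 : γ ≤ β) (h2 : β ≤ 0) (z : V3) :
    ‖z‖ ^ β ≤ max ‖z‖ 1 ^ β * kap γ z := by
  rcases le_total 1 ‖z‖ with h | h
  · rw [max_eq_left h]
    exact le_mul_of_one_le_right (Real.rpow_nonneg (norm_nonneg z) β) (one_le_kap γ z)
  · rw [max_eq_right h, Real.one_rpow, one_mul, kap]
    rcases eq_or_lt_of_le (norm_nonneg z) with h0 | h0
    · rw [← h0]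
      have : (0 : ℝ) ^ β ≤ 1 := by
        rcases eq_or_ne β 0 with rfl | hb
        · simp
        · rw [Real.zero_rpow hb]; norm_num
      have := Real.rpow_nonneg (le_refl (0 : ℝ)) γ
      linarith
    · have := Real.rpow_le_rpow_of_exponent_ge h0 h h1
      linarith

lemma norm_rpow_le_kap {γ β : ℝ} (h1 : γ ≤ β) (h2 : β ≤ 0) (z : V3) :
    ‖z‖ ^ β ≤ kap γ z := by
  refine (norm_rpow_le_max_mul_kap h1 h2 z).trans ?_
  apply mul_le_of_le_one_left (kap_nonneg γ z)
  exact Real.rpow_le_one_of_one_le_of_nonpos (le_max_right _ _) h2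

lemma norm_sub_rpow_le {γ β : ℝ} (h0 : -3 ≤ γ) (h1 : γ ≤ β) (h2 : β ≤ 0) (v w : V3) :
    ‖v - w‖ ^ β ≤ 64 * jap v ^ β * jap w ^ 3 * kap γ (v - w) := by
  refine (norm_rpow_le_max_mul_kap h1 h2 (v - w)).trans ?_
  gcongr
  · exact kap_nonneg _ _
  set s := max ‖v - w‖ 1
  have hs : 1 ≤ s := le_max_right _ _
  have hj : jap (v - w) ≤ 2 * s := by
    apply le_of_sq_le_sq _ (by positivity)
    rw [jap_sq]
    have : ‖v - w‖ ≤ s := le_max_left _ _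
    nlinarith [norm_nonneg (v - w)]
  have hw := jap_pos w
  have hv := jap_pos v
  have h3 : jap v / (4 * jap w) ≤ s := by
    rw [div_le_iff₀ (by positivity)]
    nlinarith [jap_le_mul_jap_sub v w]
  calc s ^ β ≤ (jap v / (4 * jap w)) ^ β := Real.rpow_le_rpow_of_nonpos (by positivity) h3 h2
    _ = jap v ^ β * (4 * jap w) ^ (-β) := by
      rw [Real.div_rpow hv.le (by positivity), Real.rpow_neg (by positivity)]; rfl
    _ ≤ jap v ^ β * (4 * jap w) ^ (3 : ℝ) := by
      gcongr
      · linarith [one_le_jap w]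
      · linarith
    _ = 64 * jap v ^ β * jap w ^ 3 := by
      norm_cast; ring

lemma le_norm_sub_rpow {β : ℝ} (h0 : -3 ≤ β) (h2 : β ≤ 0) {v w : V3} (h : v ≠ w) :
    1 / 8 * jap v ^ β * (jap w ^ 3)⁻¹ ≤ ‖v - w‖ ^ β := by
  have hw := jap_pos w
  have hv := jap_pos v
  have hz : 0 < ‖v - w‖ := norm_pos_iff.mpr (sub_ne_zero.mpr h)
  refine le_trans ?_ (Real.rpow_le_rpow_of_nonpos hz (norm_sub_le_mul_jap v w) h2)
  have e : (2 * jap v * jap w) ^ β = jap v ^ β * (2 * jap w) ^ β := by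
    rw [← Real.mul_rpow hv.le (by positivity)]; ring_nf
  rw [e]
  have h4 : (2 * jap w) ^ (-3 : ℝ) ≤ (2 * jap w) ^ β := by
    apply Real.rpow_le_rpow_of_exponent_le _ h0
    linarith [one_le_jap w]
  have h5 : (2 * jap w) ^ (-3 : ℝ) = 1 / 8 * (jap w ^ 3)⁻¹ := by
    rw [Real.rpow_neg (by positivity)]; norm_cast; rw [mul_pow, mul_inv]; norm_num
  rw [show 1 / 8 * jap v ^ β * (jap w ^ 3)⁻¹ = jap v ^ β * (1 / 8 * (jap w ^ 3)⁻¹) by ring, ← h5]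
  gcongr

lemma gaussM_pos (v : V3) : 0 < gaussM v := by unfold gaussM; positivity

lemma continuous_gaussM : Continuous gaussM := by unfold gaussM; fun_prop

/-- `κ` minus a bounded part is integrable. -/
def kapLoc (γ : ℝ) (z : V3) : ℝ := (Metric.ball (0 : V3) 1).indicator (fun z => ‖z‖ ^ γ) z

lemma integrable_kapLoc {γ : ℝ} (h : -3 < γ) : Integrable (kapLoc γ) := by
  unfold kapLoc
  have h1 : IntegrableOn (fun z : V3 => ‖z‖ ^ γ) (Metric.ball 0 1) := by
    have := integrableOn_fun_norm_addHaar (volume : Measure V3) (f := fun r => r ^ γ) (r := 1)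
    rw [this]
    have h2 : IntegrableOn (fun y : ℝ => y ^ (γ + 2)) (Set.Ioo 0 1) :=
      (intervalIntegral.integrableOn_Ioo_rpow_iff one_pos).mpr (by linarith)
    refine h2.congr_fun (fun y hy => ?_) measurableSet_Ioo
    have hy0 : 0 < y := hy.1
    simp only [finrank_euclideanSpace, Fintype.card_fin, smul_eq_mul]
    rw [Real.rpow_add hy0, mul_comm]; norm_num
  exact h1.integrable_indicator Metric.isOpen_ball.measurableSet

lemma kapLoc_nonneg (γ : ℝ) (z : V3) : 0 ≤ kapLoc γ z :=
  Set.indicator_nonneg (fun z _ => Real.rpow_nonneg (norm_nonneg z) γ) z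

lemma kap_le {γ : ℝ} (h : γ ≤ 0) (z : V3) : kap γ z ≤ 2 + kapLoc γ z := by
  unfold kap kapLoc
  by_cases hz : z ∈ Metric.ball (0 : V3) 1
  · rw [Set.indicator_of_mem hz]; linarith
  · rw [Set.indicator_of_notMem hz]
    have : 1 ≤ ‖z‖ := by simpa using hz
    have := Real.rpow_le_one_of_one_le_of_nonpos this h
    linarith

/-- Any moment of the Gaussian is finite. -/
lemma exists_gaussM_moment_bound (p : ℕ) : ∃ C, ∀ w : V3, jap w ^ p * gaussM w ≤ C := by
  have hc : Continuous (fun t : ℝ => (1 + t) ^ p * Real.exp (-t / 2)) := by fun_prop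
  have ht : Tendsto (fun t : ℝ => (1 + t) ^ p * Real.exp (-t / 2)) atTop (nhds 0) := by
    have h1 := (Real.tendsto_pow_mul_exp_neg_atTop_nhds_zero p)
    have h2 : Tendsto (fun t : ℝ => (1 + t) / 2) atTop atTop :=
      (tendsto_atTop_add_const_left _ 1 tendsto_id).atTop_div_const (by norm_num)
    have h3 := (h1.comp h2).const_mul (2 ^ p * Real.exp (1 / 2))
    rw [mul_zero] at h3
    refine h3.congr fun t => ?_
    simp only [Function.comp]
    rw [div_pow]
    have : Real.exp (-t / 2) = Real.exp (1 / 2) * Real.exp (-((1 + t) / 2)) := by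
      rw [← Real.exp_add]; ring_nf
    rw [this]; field_simp
  obtain ⟨T, hT⟩ := (ht.eventually (gt_mem_nhds one_pos)).exists_forall_of_atTop
  obtain ⟨B, hB⟩ := (isCompact_Icc (a := (0 : ℝ)) (b := T)).bddAbove_image hc.continuousOn
  refine ⟨(2 * Real.pi) ^ (-(3 : ℝ) / 2) * max B 1, fun w => ?_⟩
  have h1 : jap w ^ p ≤ (1 + ‖w‖ ^ 2) ^ p := by
    gcongr
    · exact (jap_pos w).le
    · nlinarith [jap_sq w, one_le_jap w]
  have h2 : (1 + ‖w‖ ^ 2) ^ p * Real.exp (-‖w‖ ^ 2 / 2) ≤ max B 1 := by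
    rcases le_total (‖w‖ ^ 2) T with h | h
    · exact le_max_of_le_left (hB ⟨‖w‖ ^ 2, ⟨by positivity, h⟩, rfl⟩)
    · exact le_max_of_le_right (hT _ h).le
  unfold gaussM
  calc jap w ^ p * ((2 * Real.pi) ^ (-(3 : ℝ) / 2) * Real.exp (-‖w‖ ^ 2 / 2))
      = (2 * Real.pi) ^ (-(3 : ℝ) / 2) * (jap w ^ p * Real.exp (-‖w‖ ^ 2 / 2)) := by ring
    _ ≤ (2 * Real.pi) ^ (-(3 : ℝ) / 2) * max B 1 := by
      gcongr
      exact (mul_le_mul_of_nonneg_right h1 (Real.exp_pos _).le).trans h2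

lemma integrable_jap_pow_mul_gaussM (p : ℕ) : Integrable (fun w : V3 => jap w ^ p * gaussM w) := by
  obtain ⟨C, hC⟩ := exists_gaussM_moment_bound (p + 4)
  have h1 : Integrable (fun w : V3 => (1 + ‖w‖ ^ 2) ^ (-(4 : ℝ) / 2)) :=
    integrable_rpow_neg_one_add_norm_sq (by simp; norm_num)
  refine (h1.const_mul C).mono'
    (((continuous_jap.pow p).mul continuous_gaussM).aestronglyMeasurable) (.of_forall fun w => ?_)
  have hw := jap_pos w
  rw [Real.norm_of_nonneg (by have := gaussM_pos w; positivity)]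
  have := hC w
  rw [← jap_rpow_eq, Real.rpow_neg hw.le]
  have e : jap w ^ (4 : ℝ) = jap w ^ 4 := by norm_cast
  rw [e, ← div_eq_mul_inv, le_div_iff₀ (by positivity)]
  calc _ = jap w ^ (p + 4) * gaussM w := by ring
    _ ≤ C := this

/-- Uniform bound for `κ` convolved with Gaussian moments. -/
lemma exists_kap_conv_bound {γ : ℝ} (h : -3 < γ) (h0 : γ ≤ 0) (p : ℕ) :
    ∃ C, 0 ≤ C ∧ ∀ v : V3, Integrable (fun w => jap w ^ p * kap γ (v - w) * gaussM w) ∧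
      ∫ w, jap w ^ p * kap γ (v - w) * gaussM w ≤ C := by
  obtain ⟨C, hC⟩ := exists_gaussM_moment_bound p
  have hC0 : 0 ≤ C := le_trans (by have := gaussM_pos 0; have := jap_pos 0; positivity) (hC 0)
  have i1 := (integrable_jap_pow_mul_gaussM p).const_mul 2
  have i2 := (integrable_kapLoc h).const_mul C
  have i3 : ∀ v, Integrable fun w => C * kapLoc γ (v - w) := fun v => i2.comp_sub_left v
  have hb : ∀ v w, jap w ^ p * kap γ (v - w) * gaussM w
      ≤ 2 * (jap w ^ p * gaussM w) + C * kapLoc γ (v - w) := by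
    intro v w
    have h1 := kap_le h0 (v - w)
    have h2 := hC w
    have h3 := kapLoc_nonneg γ (v - w)
    have h4 := gaussM_pos w
    have h5 := jap_pos w
    have h6 : 0 ≤ jap w ^ p * gaussM w := by positivity
    nlinarith [mul_le_mul_of_nonneg_right h2 h3, mul_le_mul_of_nonneg_left h1 h6]
  have hi : ∀ v, Integrable (fun w => jap w ^ p * kap γ (v - w) * gaussM w) := fun v => by
    refine (i1.add (i3 v)).mono' ?_ (.of_forall fun w => ?_)
    · apply Measurable.aestronglyMeasurable
      have := measurable_kap γ
      have := continuous_jap.measurable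
      have := continuous_gaussM.measurable
      fun_prop
    · rw [Real.norm_of_nonneg]
      · exact hb v w
      · have := gaussM_pos w
        have := kap_nonneg γ (v - w)
        have := jap_pos w
        positivity
  refine ⟨(∫ w, 2 * (jap w ^ p * gaussM w)) + ∫ w, C * kapLoc γ w, ?_, fun v => ⟨hi v, ?_⟩⟩
  · apply add_nonneg <;> apply integral_nonneg <;> intro w
    · have := gaussM_pos w
      have := jap_pos w
      simp only [Pi.zero_apply]; positivity
    · have := kapLoc_nonneg γ w
      simp only [Pi.zero_apply]; positivity
  · calc _ ≤ ∫ w, (2 * (jap w ^ p * gaussM w) + C * kapLoc γ (v - w)) :=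
        integral_mono (hi v) (i1.add (i3 v)) (hb v)
      _ = _ := by
        rw [integral_add i1 (i3 v)]
        congr 1
        exact integral_sub_left_eq_self (fun w => C * kapLoc γ w) volume v

lemma integrable_kernel_mul_gaussM {γ C : ℝ} (h : -3 < γ) (h0 : γ ≤ 0) {K : V3 → ℝ}
    (hK : Measurable K) (hb : ∀ z, |K z| ≤ C * kap γ z) (v : V3) :
    Integrable (fun w => K (v - w) * gaussM w) := by
  obtain ⟨_, _, hD⟩ := exists_kap_conv_bound h h0 0
  refine ((hD v).1.const_mul C).mono' ?_ (.of_forall fun w => ?_)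
  · have := continuous_gaussM.measurable
    exact Measurable.aestronglyMeasurable (by fun_prop)
  · rw [norm_mul, Real.norm_eq_abs, Real.norm_of_nonneg (gaussM_pos w).le]
    calc _ ≤ C * kap γ (v - w) * gaussM w := by
          gcongr
          · exact (gaussM_pos w).le
          · exact hb _
      _ = _ := by ring

lemma SchwartzMap.exists_abs_le (G : SchwartzMap V3 ℝ) : ∃ B, 0 ≤ B ∧ ∀ v, |G v| ≤ B :=
  ⟨SchwartzMap.seminorm ℝ 0 0 G, apply_nonneg _ _, fun v => SchwartzMap.norm_le_seminorm ℝ G v⟩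

lemma integrable_prod_kernel {γ C : ℝ} (h : -3 < γ) (h0 : γ ≤ 0) {K : V3 → ℝ}
    (hK : Measurable K) (hC : 0 ≤ C) (hb : ∀ z, |K z| ≤ C * kap γ z) (G : SchwartzMap V3 ℝ) :
    Integrable (fun p : V3 × V3 => K (p.1 - p.2) * gaussM p.2 * G p.1)
      (volume.prod volume) := by
  obtain ⟨B, hB0, hB⟩ := G.exists_abs_le
  have hg : Integrable gaussM := by simpa using integrable_jap_pow_mul_gaussM 0
  have i1 : Integrable (fun p : V3 × V3 => |G p.1| * gaussM p.2) (volume.prod volume) :=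
    (G.integrable (μ := volume)).abs.mul_prod hg
  have i2 : Integrable (fun p : V3 × V3 => gaussM p.2 * kapLoc γ (p.1 - p.2))
      (volume.prod volume) :=
    Integrable.convolution_integrand (ContinuousLinearMap.mul ℝ ℝ) hg (integrable_kapLoc h)
  refine ((i1.const_mul (2 * C)).add (i2.const_mul (C * B))).mono' ?_ (.of_forall fun p => ?_)
  · have := continuous_gaussM.measurable
    have := G.continuous.measurable
    exact Measurable.aestronglyMeasurable (by fun_prop)
  · have hg := gaussM_pos p.2
    have hk := kap_le h0 (p.1 - p.2)
    have hk' := kapLoc_nonneg γ (p.1 - p.2)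
    rw [norm_mul, norm_mul, Real.norm_eq_abs, Real.norm_eq_abs, Real.norm_eq_abs,
      abs_of_pos hg]
    calc _ ≤ (C * (2 + kapLoc γ (p.1 - p.2))) * gaussM p.2 * |G p.1| := by
          gcongr
          exact (hb _).trans (by gcongr)
      _ = 2 * C * (|G p.1| * gaussM p.2)
          + C * (gaussM p.2 * kapLoc γ (p.1 - p.2)) * |G p.1| := by ring
      _ ≤ 2 * C * (|G p.1| * gaussM p.2)
          + C * (gaussM p.2 * kapLoc γ (p.1 - p.2)) * B := by
          gcongr
          exact hB _
      _ = _ := by simp only [Pi.add_apply]; ring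

lemma integrable_kernel_mul_schwartz {γ C : ℝ} (h : -3 < γ) (h0 : γ ≤ 0) {K : V3 → ℝ}
    (hK : Measurable K) (hC : 0 ≤ C) (hb : ∀ z, |K z| ≤ C * kap γ z) (G : SchwartzMap V3 ℝ)
    (w : V3) : Integrable (fun v => K (v - w) * G v) := by
  obtain ⟨B, hB0, hB⟩ := G.exists_abs_le
  have i1 := (G.integrable (μ := volume)).abs
  have i2 := (integrable_kapLoc h).comp_sub_right w
  refine ((i1.const_mul (2 * C)).add (i2.const_mul (C * B))).mono' ?_ (.of_forall fun v => ?_)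
  · have := G.continuous.measurable
    exact Measurable.aestronglyMeasurable (by fun_prop)
  · have hk := kap_le h0 (v - w)
    have hk' := kapLoc_nonneg γ (v - w)
    rw [norm_mul, Real.norm_eq_abs, Real.norm_eq_abs]
    calc _ ≤ (C * (2 + kapLoc γ (v - w))) * |G v| := by
          gcongr
          exact (hb _).trans (by gcongr)
      _ = 2 * C * |G v| + C * kapLoc γ (v - w) * |G v| := by ring
      _ ≤ 2 * C * |G v| + C * kapLoc γ (v - w) * B := by
          gcongr
          exact hB _
      _ = _ := by simp only [Pi.add_apply]; ring

lemma integrable_conv_mul_schwartz {γ C : ℝ} (h : -3 < γ) (h0 : γ ≤ 0) {K : V3 → ℝ}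
    (hK : Measurable K) (hC : 0 ≤ C) (hb : ∀ z, |K z| ≤ C * kap γ z) (G : SchwartzMap V3 ℝ) :
    Integrable (fun v => (∫ w, K (v - w) * gaussM w) * G v) := by
  have := (integrable_prod_kernel h h0 hK hC hb G).integral_prod_left
  simpa only [integral_mul_const] using this

lemma pd_mul {f g : V3 → ℝ} {v : V3} (hf : DifferentiableAt ℝ f v) (hg : DifferentiableAt ℝ g v)
    (i : Fin 3) : pd i (fun x => f x * g x) v = pd i f v * g v + f v * pd i g v := by
  unfold pd
  rw [fderiv_fun_mul hf hg]
  simp; ring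

lemma pd_sub_right (f : V3 → ℝ) (w v : V3) (i : Fin 3) :
    pd i (fun x => f (x - w)) v = pd i f (v - w) := by
  unfold pd
  rw [fderiv_comp_sub]

lemma pd_coord (i j : Fin 3) (v : V3) : pd i (fun x : V3 => x j) v = if i = j then 1 else 0 := by
  unfold pd
  have : HasFDerivAt (fun x : V3 => x j) (EuclideanSpace.proj j : V3 →L[ℝ] ℝ) v :=
    (EuclideanSpace.proj j : V3 →L[ℝ] ℝ).hasFDerivAt
  rw [this.fderiv]
  simp [eq_comm]

lemma hasFDerivAt_add_norm_sq_rpow {c : ℝ} (hc : 0 < c) (s : ℝ) (v : V3) :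
    HasFDerivAt (fun x : V3 => (c + ‖x‖ ^ 2) ^ s)
      ((s * (c + ‖v‖ ^ 2) ^ (s - 1)) • ((2 : ℝ) • innerSL ℝ v)) v := by
  have h1 : HasFDerivAt (fun x : V3 => c + ‖x‖ ^ 2) ((2 : ℝ) • innerSL ℝ v) v := by
    refine ((hasStrictFDerivAt_norm_sq v).hasFDerivAt.const_add c).congr_fderiv ?_
    rw [two_nsmul, two_smul]
  exact h1.rpow_const (Or.inl (by positivity))

lemma pd_add_norm_sq_rpow {c : ℝ} (hc : 0 < c) (s : ℝ) (v : V3) (i : Fin 3) :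
    pd i (fun x : V3 => (c + ‖x‖ ^ 2) ^ s) v = 2 * s * v i * (c + ‖v‖ ^ 2) ^ (s - 1) := by
  unfold pd
  rw [(hasFDerivAt_add_norm_sq_rpow hc s v).fderiv]
  simp [EuclideanSpace.inner_single_right]; ring

lemma differentiableAt_coord (j : Fin 3) (v : V3) : DifferentiableAt ℝ (fun x : V3 => x j) v :=
  (EuclideanSpace.proj j : V3 →L[ℝ] ℝ).differentiableAt

lemma hasTemperateGrowth_coord (j : Fin 3) : (fun x : V3 => x j).HasTemperateGrowth :=
  (EuclideanSpace.proj j : V3 →L[ℝ] ℝ).hasTemperateGrowth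

lemma hasTemperateGrowth_add_norm_sq_rpow {c : ℝ} (hc : 0 < c) (s : ℝ) :
    (fun x : V3 => (c + ‖x‖ ^ 2) ^ s).HasTemperateGrowth := by
  have h1 := (Function.hasTemperateGrowth_one_add_norm_sq_rpow V3 s).comp
    (((Real.sqrt c)⁻¹ • ContinuousLinearMap.id ℝ V3).hasTemperateGrowth)
  have h2 := (Function.HasTemperateGrowth.const (E := V3) (c ^ s)).mul h1
  have e : (fun x : V3 => (c + ‖x‖ ^ 2) ^ s)
      = fun x => c ^ s * (1 + ‖(Real.sqrt c)⁻¹ • x‖ ^ 2) ^ s := by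
    funext x
    rw [← Real.mul_rpow hc.le (by positivity), norm_smul, mul_pow, norm_inv, inv_pow,
      Real.norm_eq_abs, sq_abs, Real.sq_sqrt hc.le, mul_add, ← mul_assoc, mul_inv_cancel₀ hc.ne']
    simp
  rw [e]
  exact h2

/-- Multiplication of a Schwartz function by a function of temperate growth. -/
lemma exists_schwartz_mul {g : V3 → ℝ} (hg : g.HasTemperateGrowth) (G : SchwartzMap V3 ℝ) :
    ∃ F : SchwartzMap V3 ℝ, ∀ v, F v = g v * G v :=
  ⟨SchwartzMap.smulLeftCLM ℝ g G, fun v => SchwartzMap.smulLeftCLM_apply_apply hg G v⟩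

lemma exists_schwartz_pd (G : SchwartzMap V3 ℝ) (i : Fin 3) :
    ∃ F : SchwartzMap V3 ℝ, ∀ v, F v = pd i G v :=
  ⟨LineDeriv.lineDerivOp (EuclideanSpace.single i (1 : ℝ)) G, fun _ => rfl⟩

lemma integral_pd_schwartz (G : SchwartzMap V3 ℝ) (i : Fin 3) : ∫ v, pd i G v = 0 := by
  obtain ⟨F, hF⟩ := exists_schwartz_pd G i
  have h := integral_mul_fderiv_eq_neg_fderiv_mul_of_integrable (μ := (volume : Measure V3))
    (f := fun _ => (1 : ℝ)) (g := G) (v := EuclideanSpace.single i 1) (by simp)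
    (by simp only [one_mul]; exact F.integrable.congr (.of_forall hF))
    (by simpa only [one_mul] using G.integrable) (by simp) (fun x _ => G.differentiableAt)
  simp only [one_mul, fderiv_fun_const, Pi.zero_apply, zero_apply, zero_mul, integral_zero,
    neg_zero] at h
  exact h

/-- Divergence theorem for the field `(ε + |z|²)^s p(z) G`, with `z = v - w`. -/
lemma integral_div_regularized {p : Fin 3 → V3 → ℝ} (hp : ∀ i, (p i).HasTemperateGrowth)
    (s : ℝ) {ε : ℝ} (hε : 0 < ε) (G : SchwartzMap V3 ℝ) (w : V3) :
    ∫ v, ((∑ i, (ε + ‖v - w‖ ^ 2) ^ s * p i (v - w) * pd i G v)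
      + (2 * s * (ε + ‖v - w‖ ^ 2) ^ (s - 1) * (∑ i, (v - w) i * p i (v - w))
        + (ε + ‖v - w‖ ^ 2) ^ s * ∑ i, pd i (p i) (v - w)) * G v) = 0 := by
  have hsub : (fun v : V3 => v - w).HasTemperateGrowth :=
    Function.HasTemperateGrowth.id'.sub (.const w)
  have hg : ∀ i, (fun z : V3 => (ε + ‖z‖ ^ 2) ^ s * p i z).HasTemperateGrowth := fun i =>
    (hasTemperateGrowth_add_norm_sq_rpow hε s).mul (hp i)
  choose F hF using fun i => exists_schwartz_mul ((hg i).comp hsub) G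
  have hpd : ∀ i v, pd i (F i) v = (ε + ‖v - w‖ ^ 2) ^ s * p i (v - w) * pd i G v
      + (2 * s * (ε + ‖v - w‖ ^ 2) ^ (s - 1) * ((v - w) i * p i (v - w))
        + (ε + ‖v - w‖ ^ 2) ^ s * pd i (p i) (v - w)) * G v := by
    intro i v
    have hdg : Differentiable ℝ (fun z : V3 => (ε + ‖z‖ ^ 2) ^ s * p i z) :=
      (hg i).1.differentiable (by simp)
    have e : (F i : V3 → ℝ) = fun x => (fun y => (fun z : V3 => (ε + ‖z‖ ^ 2) ^ s * p i z) (y - w)) x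
        * G x := funext (hF i)
    rw [e, pd_mul _ G.differentiableAt,
      pd_sub_right (fun z : V3 => (ε + ‖z‖ ^ 2) ^ s * p i z), pd_mul, pd_add_norm_sq_rpow hε]
    · ring
    · exact (hasFDerivAt_add_norm_sq_rpow hε s _).differentiableAt
    · exact (hp i).1.differentiable (by simp) _
    · exact (hdg _).comp v (by fun_prop)
  choose F' hF' using fun i => exists_schwartz_pd (F i) i
  calc _ = ∫ v, ∑ i, pd i (F i) v := by
        congr 1; funext v
        simp only [hpd, Fin.sum_univ_three]; ring
    _ = ∑ i, ∫ v, pd i (F i) v :=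
        integral_finsetSum _ fun i _ => (F' i).integrable.congr (.of_forall (hF' i))
    _ = 0 := by simp [integral_pd_schwartz]

/-- Weak divergence of the homogeneous field `|z|^γ p(z)`. -/
lemma integral_weak_div {γ C : ℝ} (h : -3 < γ) (h0 : γ ≤ 0) {p : Fin 3 → V3 → ℝ}
    (hp : ∀ i, (p i).HasTemperateGrowth) {r q : V3 → ℝ} (hrm : Measurable r) (hqm : Measurable q)
    (hr : ∀ z, ∑ i, z i * p i z = r z) (hq : ∀ z, ∑ i, pd i (p i) z = q z)
    (hpb : ∀ i z, z ≠ 0 → ‖z‖ ^ γ * |p i z| ≤ C * kap γ z)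
    (hrb : ∀ z, z ≠ 0 → ‖z‖ ^ (γ - 2) * |γ * r z| ≤ C * kap γ z)
    (hqb : ∀ z, z ≠ 0 → ‖z‖ ^ γ * |q z| ≤ C * kap γ z) (G : SchwartzMap V3 ℝ) (w : V3) :
    ∫ v, ((∑ i, ‖v - w‖ ^ γ * p i (v - w) * pd i G v)
      + (γ * ‖v - w‖ ^ (γ - 2) * r (v - w) + ‖v - w‖ ^ γ * q (v - w)) * G v) = 0 := by
  choose G' hG' using fun i => exists_schwartz_pd G i
  have hpm : ∀ i, Measurable (p i) := fun i => (hp i).1.continuous.measurable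
  have hGm : Measurable G := G.continuous.measurable
  have hG'm : ∀ i, Measurable (pd i G) := fun i => by
    rw [← funext (hG' i)]; exact (G' i).continuous.measurable
  set e : ℕ → ℝ := fun n => 1 / ((n : ℝ) + 1)
  have he : ∀ n, 0 < e n := fun n => by positivity
  have hne : ∀ᵐ v : V3, v - w ≠ 0 := by
    have : ∀ᵐ v : V3, v ≠ w := by simp [ae_iff]
    filter_upwards [this] with v hv using sub_ne_zero.mpr hv
  have hpow : ∀ (z : V3) (s : ℝ), (‖z‖ ^ 2) ^ s = ‖z‖ ^ (2 * s) := fun z s => by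
    rw [Real.rpow_mul (norm_nonneg z)]; norm_cast
  have hle : ∀ (z : V3) (s : ℝ) n, z ≠ 0 → s ≤ 0 → (e n + ‖z‖ ^ 2) ^ s ≤ ‖z‖ ^ (2 * s) := by
    intro z s n hz hs
    rw [← hpow]
    have : 0 < ‖z‖ := norm_pos_iff.mpr hz
    exact Real.rpow_le_rpow_of_nonpos (by positivity) (by linarith [he n]) hs
  have hk : ∀ F : SchwartzMap V3 ℝ, Integrable fun v => C * |kap γ (v - w) * F v| := fun F =>
    (integrable_kernel_mul_schwartz (C := 1) h h0 (measurable_kap γ) zero_le_one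
      (fun z => by rw [one_mul, abs_of_nonneg (kap_nonneg γ z)]) F w).abs.const_mul C
  have key := tendsto_integral_of_dominated_convergence (μ := (volume : Measure V3))
    (F := fun n v => ((∑ i, (e n + ‖v - w‖ ^ 2) ^ (γ / 2) * p i (v - w) * pd i G v)
      + (2 * (γ / 2) * (e n + ‖v - w‖ ^ 2) ^ (γ / 2 - 1) * (∑ i, (v - w) i * p i (v - w))
        + (e n + ‖v - w‖ ^ 2) ^ (γ / 2) * ∑ i, pd i (p i) (v - w)) * G v))
    (f := fun v => ((∑ i, ‖v - w‖ ^ γ * p i (v - w) * pd i G v)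
      + (γ * ‖v - w‖ ^ (γ - 2) * r (v - w) + ‖v - w‖ ^ γ * q (v - w)) * G v))
    (fun v => (∑ i, C * |kap γ (v - w) * G' i v|) + (C * |kap γ (v - w) * G v|
      + C * |kap γ (v - w) * G v|)) ?_ ?_ ?_ ?_
  · refine tendsto_nhds_unique key ?_
    simp only [integral_div_regularized hp _ (he _)]
    exact tendsto_const_nhds
  · intro n
    simp only [hr, hq]
    exact Measurable.aestronglyMeasurable (by fun_prop)
  · exact (integrable_finsetSum _ fun i _ => hk (G' i)).add ((hk G).add (hk G))
  · intro n
    filter_upwards [hne] with v hv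
    simp only [hr, hq]
    have k0 := kap_nonneg γ (v - w)
    have b1 : ‖(∑ i, (e n + ‖v - w‖ ^ 2) ^ (γ / 2) * p i (v - w) * pd i G v)‖
        ≤ ∑ i, C * |kap γ (v - w) * G' i v| := by
      refine norm_sum_le_of_le _ fun i _ => ?_
      rw [norm_mul, norm_mul, Real.norm_of_nonneg (Real.rpow_nonneg (by have := he n; positivity) _),
        abs_mul, abs_of_nonneg k0, ← mul_assoc, ← hG' i]
      refine mul_le_mul_of_nonneg_right (le_trans ?_ (hpb i _ hv)) (abs_nonneg _)
      refine mul_le_mul_of_nonneg_right ((hle _ _ n hv (by linarith)).trans_eq ?_) (abs_nonneg _)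
      ring_nf
    have b2 : ‖2 * (γ / 2) * (e n + ‖v - w‖ ^ 2) ^ (γ / 2 - 1) * r (v - w) * G v‖
        ≤ C * |kap γ (v - w) * G v| := by
      rw [abs_mul, abs_of_nonneg k0, ← mul_assoc, norm_mul]
      refine mul_le_mul_of_nonneg_right (le_trans ?_ (hrb _ hv)) (abs_nonneg _)
      rw [show 2 * (γ / 2) * (e n + ‖v - w‖ ^ 2) ^ (γ / 2 - 1) * r (v - w)
        = (e n + ‖v - w‖ ^ 2) ^ (γ / 2 - 1) * (γ * r (v - w)) by ring, norm_mul,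
        Real.norm_of_nonneg (Real.rpow_nonneg (by have := he n; positivity) _)]
      refine mul_le_mul_of_nonneg_right ((hle _ _ n hv (by linarith)).trans_eq ?_) (abs_nonneg _)
      ring_nf
    have b3 : ‖(e n + ‖v - w‖ ^ 2) ^ (γ / 2) * q (v - w) * G v‖
        ≤ C * |kap γ (v - w) * G v| := by
      rw [abs_mul, abs_of_nonneg k0, ← mul_assoc, norm_mul, norm_mul,
        Real.norm_of_nonneg (Real.rpow_nonneg (by have := he n; positivity) _)]
      refine mul_le_mul_of_nonneg_right (le_trans ?_ (hqb _ hv)) (abs_nonneg _)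
      refine mul_le_mul_of_nonneg_right ((hle _ _ n hv (by linarith)).trans_eq ?_) (abs_nonneg _)
      ring_nf
    rw [add_mul]
    exact (norm_add_le _ _).trans (add_le_add b1 ((norm_add_le _ _).trans (add_le_add b2 b3)))
  · filter_upwards [hne] with v hv
    simp only [hr, hq]
    have hz : 0 < ‖v - w‖ := norm_pos_iff.mpr hv
    have het : Tendsto (fun n => e n + ‖v - w‖ ^ 2) atTop (nhds (‖v - w‖ ^ 2)) := by
      have := tendsto_one_div_add_atTop_nhds_zero_nat (𝕜 := ℝ)
      simpa [e] using this.add_const (‖v - w‖ ^ 2)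
    have ht : ∀ s : ℝ, Tendsto (fun n => (e n + ‖v - w‖ ^ 2) ^ s) atTop (nhds (‖v - w‖ ^ (2 * s))) := by
      intro s
      rw [← hpow]
      exact het.rpow_const (Or.inl (by positivity))
    have t1 := ht (γ / 2)
    have t2 := ht (γ / 2 - 1)
    rw [show 2 * (γ / 2) = γ by ring] at t1
    rw [show 2 * (γ / 2 - 1) = γ - 2 by ring] at t2
    rw [show 2 * (γ / 2) = γ by ring]
    refine Tendsto.add (tendsto_finsetSum _ fun i _ => (t1.mul_const _).mul_const _) ?_
    exact (((t2.const_mul γ).mul_const _).add (t1.mul_const _)).mul_const _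

/-- A weak divergence identity for a family of translates survives averaging against the
Gaussian. -/
lemma integral_conv_weak_div {γ C : ℝ} (h : -3 < γ) (h0 : γ ≤ 0) (hC : 0 ≤ C)
    {K : Fin 3 → V3 → ℝ} {D : V3 → ℝ} (hK : ∀ i, Measurable (K i)) (hD : Measurable D)
    (hKb : ∀ i z, |K i z| ≤ C * kap γ z) (hDb : ∀ z, |D z| ≤ C * kap γ z)
    (G : SchwartzMap V3 ℝ)
    (hw : ∀ w, ∫ v, ((∑ i, K i (v - w) * pd i G v) + D (v - w) * G v) = 0) :
    Integrable (fun v => (∑ i, (∫ w, K i (v - w) * gaussM w) * pd i G v)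
        + (∫ w, D (v - w) * gaussM w) * G v) ∧
      ∫ v, ((∑ i, (∫ w, K i (v - w) * gaussM w) * pd i G v)
        + (∫ w, D (v - w) * gaussM w) * G v) = 0 := by
  choose G' hG' using fun i => exists_schwartz_pd G i
  have hG'' : ∀ i, pd i G = G' i := fun i => (funext (hG' i)).symm
  simp only [hG''] at hw ⊢
  refine ⟨(integrable_finsetSum _ fun i _ => integrable_conv_mul_schwartz h h0 (hK i) hC (hKb i)
    (G' i)).add (integrable_conv_mul_schwartz h h0 hD hC hDb G), ?_⟩
  have hint : Integrable (Function.uncurry fun v w : V3 =>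
      (∑ i, K i (v - w) * gaussM w * G' i v) + D (v - w) * gaussM w * G v)
      ((volume : Measure V3).prod volume) :=
    (integrable_finsetSum _ fun i _ => integrable_prod_kernel h h0 (hK i) hC (hKb i) (G' i)).add
      (integrable_prod_kernel h h0 hD hC hDb G)
  calc _ = ∫ v, ∫ w, ((∑ i, K i (v - w) * gaussM w * G' i v) + D (v - w) * gaussM w * G v) := by
        congr 1; funext v
        have i1 : ∀ i ∈ Finset.univ, Integrable fun w => K i (v - w) * gaussM w * G' i v :=
          fun i _ => (integrable_kernel_mul_gaussM h h0 (hK i) (hKb i) v).mul_const _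
        rw [integral_add (integrable_finsetSum _ i1)
          ((integrable_kernel_mul_gaussM h h0 hD hDb v).mul_const _), integral_finsetSum _ i1]
        simp only [integral_mul_const]
    _ = ∫ w, ∫ v, ((∑ i, K i (v - w) * gaussM w * G' i v) + D (v - w) * gaussM w * G v) :=
        integral_integral_swap hint
    _ = ∫ w, gaussM w * ∫ v, ((∑ i, K i (v - w) * G' i v) + D (v - w) * G v) := by
        congr 1; funext w
        rw [← integral_const_mul]
        congr 1; funext v
        rw [mul_add, Finset.mul_sum]
        congr 1
        · exact Finset.sum_congr rfl fun i _ => by ring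
        · ring
    _ = 0 := by simp [hw]

lemma aker_eq {γ : ℝ} (h : γ < -2) (z : V3) (i j : Fin 3) :
    aker γ z i j = ‖z‖ ^ γ * (‖z‖ ^ 2 * (if i = j then 1 else 0) - z i * z j) := by
  unfold aker
  rcases eq_or_ne z 0 with rfl | hz
  · simp [Real.zero_rpow (show γ + 2 ≠ 0 by linarith)]
  · have hz : 0 < ‖z‖ := norm_pos_iff.mpr hz
    rw [Real.rpow_add hz]
    norm_cast
    field_simp

lemma bker_eq (γ : ℝ) (z : V3) (i : Fin 3) : bker γ z i = ‖z‖ ^ γ * (-2 * z i) := by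
  unfold bker; ring

/-- The divergence of `b`. -/
def cker (γ : ℝ) (z : V3) : ℝ := -2 * (γ + 3) * ‖z‖ ^ γ

lemma cbar_eq (γ : ℝ) (v : V3) : cbar γ v = ∫ w, cker γ (v - w) * gaussM w := by
  unfold cbar Jfun cker
  rw [← integral_const_mul]
  congr 1; funext w; ring

lemma abs_coord_le (z : V3) (i : Fin 3) : |z i| ≤ ‖z‖ := by
  simpa using PiLp.norm_apply_le z i

lemma abs_le_kap_of_sq {γ : ℝ} (h : -3 < γ) (h2 : γ < -2) (z : V3) :
    ‖z‖ ^ γ * ‖z‖ ^ 2 ≤ kap γ z ∧ ‖z‖ ^ γ * ‖z‖ ≤ kap γ z ∧ ‖z‖ ^ γ ≤ kap γ z := by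
  have e0 := norm_rpow_le_kap (γ := γ) le_rfl (by linarith) z
  have e1 := norm_rpow_le_kap (γ := γ) (β := γ + 1) (by linarith) (by linarith) z
  have e2 := norm_rpow_le_kap (γ := γ) (β := γ + 2) (by linarith) (by linarith) z
  rcases eq_or_ne z 0 with rfl | hz
  · have := kap_nonneg γ 0
    exact ⟨by simpa using this, by simpa using this, e0⟩
  · have hz : 0 < ‖z‖ := norm_pos_iff.mpr hz
    rw [Real.rpow_add hz] at e1 e2
    norm_cast at e1 e2
    exact ⟨e2, by simpa using e1, e0⟩

lemma abs_aker_poly_le (z : V3) (i j : Fin 3) :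
    |‖z‖ ^ 2 * (if i = j then 1 else 0) - z i * z j| ≤ 6 * ‖z‖ ^ 2 := by
  have h1 : |z i * z j| ≤ ‖z‖ ^ 2 := by
    rw [abs_mul, sq]
    exact mul_le_mul (abs_coord_le z i) (abs_coord_le z j) (abs_nonneg _) (norm_nonneg _)
  have h2 := abs_le.mp h1
  have := sq_nonneg ‖z‖
  rw [abs_le]
  split_ifs <;> constructor <;> linarith

lemma measurable_aker (γ : ℝ) (i j : Fin 3) : Measurable fun z => aker γ z i j := by
  unfold aker; fun_prop

lemma measurable_bker (γ : ℝ) (i : Fin 3) : Measurable fun z => bker γ z i := by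
  unfold bker; fun_prop

lemma measurable_cker (γ : ℝ) : Measurable fun z => cker γ z := by
  unfold cker; fun_prop

section

variable {γ : ℝ}

lemma abs_aker_le (h : -3 < γ) (h2 : γ < -2) (i j : Fin 3) (z : V3) :
    |aker γ z i j| ≤ 6 * kap γ z := by
  rw [aker_eq h2, abs_mul, abs_of_nonneg (Real.rpow_nonneg (norm_nonneg z) γ)]
  have := mul_le_mul_of_nonneg_left (abs_aker_poly_le z i j) (Real.rpow_nonneg (norm_nonneg z) γ)
  linarith [(abs_le_kap_of_sq h h2 z).1]

lemma abs_bker_le (h : -3 < γ) (h2 : γ < -2) (i : Fin 3) (z : V3) :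
    |bker γ z i| ≤ 6 * kap γ z := by
  rw [bker_eq, abs_mul, abs_of_nonneg (Real.rpow_nonneg (norm_nonneg z) γ), abs_mul]
  have := mul_le_mul_of_nonneg_left (abs_coord_le z i) (Real.rpow_nonneg (norm_nonneg z) γ)
  have := kap_nonneg γ z
  norm_num
  linarith [(abs_le_kap_of_sq h h2 z).2.1]

lemma abs_cker_le (h : -3 < γ) (h2 : γ < -2) (z : V3) : |cker γ z| ≤ 6 * kap γ z := by
  have hn := Real.rpow_nonneg (norm_nonneg z) γ
  unfold cker
  rw [abs_mul, abs_mul, abs_of_nonneg hn, abs_of_pos (show 0 < γ + 3 by linarith)]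
  have := kap_nonneg γ z
  norm_num
  nlinarith [(abs_le_kap_of_sq h h2 z).2.2]

lemma norm_sq_eq_sum (z : V3) : ‖z‖ ^ 2 = z 0 ^ 2 + z 1 ^ 2 + z 2 ^ 2 := by
  rw [EuclideanSpace.norm_sq_eq, Fin.sum_univ_three]; simp

lemma differentiable_norm_sq (z : V3) : DifferentiableAt ℝ (fun x : V3 => ‖x‖ ^ 2) z :=
  (hasStrictFDerivAt_norm_sq z).hasFDerivAt.differentiableAt

lemma pd_norm_sq (i : Fin 3) (z : V3) : pd i (fun x : V3 => ‖x‖ ^ 2) z = 2 * z i := by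
  unfold pd
  rw [(hasStrictFDerivAt_norm_sq z).hasFDerivAt.fderiv, two_nsmul]
  simp [EuclideanSpace.inner_single_right]; ring

lemma pd_const_mul {f : V3 → ℝ} {v : V3} (hf : DifferentiableAt ℝ f v) (c : ℝ) (i : Fin 3) :
    pd i (fun x => c * f x) v = c * pd i f v := by
  unfold pd
  rw [fderiv_const_mul hf]; rfl

lemma pd_sub {f g : V3 → ℝ} {v : V3} (hf : DifferentiableAt ℝ f v) (hg : DifferentiableAt ℝ g v)
    (i : Fin 3) : pd i (fun x => f x - g x) v = pd i f v - pd i g v := by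
  unfold pd
  rw [fderiv_fun_sub hf hg]; rfl

lemma integral_aker_weak_div (h : -3 < γ) (h2 : γ < -2) (j : Fin 3) (G : SchwartzMap V3 ℝ)
    (w : V3) :
    ∫ v, ((∑ i, aker γ (v - w) i j * pd i G v) + bker γ (v - w) j * G v) = 0 := by
  have key := integral_weak_div (γ := γ) (C := 6) h (by linarith)
    (p := fun i z => (if i = j then 1 else 0) * ‖z‖ ^ 2 - z i * z j) (r := fun _ => 0)
    (q := fun z => -2 * z j)
    (fun i => ((Function.HasTemperateGrowth.const _).mul
      (Function.hasTemperateGrowth_norm_sq V3)).sub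
      ((hasTemperateGrowth_coord i).mul (hasTemperateGrowth_coord j)))
    measurable_const (by fun_prop) ?_ ?_ ?_ ?_ ?_ G w
  · rw [← key]
    congr 1; funext v
    simp only [aker_eq h2, bker_eq]
    simp only [mul_zero, zero_add, mul_comm (‖v - w‖ ^ 2)]
  · intro z
    rw [Fin.sum_univ_three, norm_sq_eq_sum]
    fin_cases j <;> simp <;> ring
  · intro z
    have : ∀ i, pd i (fun z : V3 => (if i = j then (1 : ℝ) else 0) * ‖z‖ ^ 2 - z i * z j) z
        = (if i = j then 1 else 0) * (2 * z i) - (z j + z i * if i = j then 1 else 0) := by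
      intro i
      rw [pd_sub (f := fun z : V3 => (if i = j then (1 : ℝ) else 0) * ‖z‖ ^ 2)
        (g := fun z : V3 => z i * z j) ((differentiable_norm_sq z).const_mul _)
        ((differentiableAt_coord i z).mul (differentiableAt_coord j z)),
        pd_const_mul (differentiable_norm_sq z), pd_norm_sq,
        pd_mul (differentiableAt_coord i z) (differentiableAt_coord j z), pd_coord, pd_coord]
      simp
    simp only [this, Fin.sum_univ_three]
    fin_cases j <;> simp <;> ring
  · intro i z _
    rw [mul_comm (if i = j then (1 : ℝ) else 0)]
    have := mul_le_mul_of_nonneg_left (abs_aker_poly_le z i j) (Real.rpow_nonneg (norm_nonneg z) γ)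
    linarith [(abs_le_kap_of_sq h h2 z).1]
  · intro z _
    simpa using kap_nonneg γ z
  · intro z _
    have := abs_bker_le h h2 j z
    rwa [bker_eq, abs_mul, abs_of_nonneg (Real.rpow_nonneg (norm_nonneg z) γ)] at this

lemma integral_bker_weak_div (h : -3 < γ) (h2 : γ < -2) (G : SchwartzMap V3 ℝ) (w : V3) :
    ∫ v, ((∑ i, bker γ (v - w) i * pd i G v) + cker γ (v - w) * G v) = 0 := by
  have hpow : ∀ z : V3, ‖z‖ ^ (γ - 2) * ‖z‖ ^ 2 = ‖z‖ ^ γ := by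
    intro z
    rcases eq_or_ne z 0 with rfl | hz
    · simp [Real.zero_rpow (show γ ≠ 0 by linarith)]
    · have hz : 0 < ‖z‖ := norm_pos_iff.mpr hz
      rw [Real.rpow_sub hz]; norm_cast; field_simp
  have key := integral_weak_div (γ := γ) (C := 6) h (by linarith)
    (p := fun i z => -2 * z i) (r := fun z => -2 * ‖z‖ ^ 2)
    (q := fun _ => -6)
    (fun i => (Function.HasTemperateGrowth.const _).mul (hasTemperateGrowth_coord i))
    (by fun_prop) (by fun_prop) ?_ ?_ ?_ ?_ ?_ G w
  · rw [← key]
    congr 1; funext v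
    simp only [cker, bker_eq]
    rw [← hpow (v - w)]
    congr 2
    ring
  · intro z
    rw [Fin.sum_univ_three, norm_sq_eq_sum]
    ring
  · intro z
    simp only [pd_const_mul (differentiableAt_coord _ z), pd_coord]
    simp; norm_num
  · intro i z _
    have := abs_bker_le h h2 i z
    rwa [bker_eq, abs_mul, abs_of_nonneg (Real.rpow_nonneg (norm_nonneg z) γ)] at this
  · intro z _
    rw [abs_mul, abs_mul, abs_of_neg (show γ < 0 by linarith), abs_of_nonneg (sq_nonneg ‖z‖)]
    have h3 := hpow z
    have h4 := (abs_le_kap_of_sq h h2 z).2.2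
    have h5 := Real.rpow_nonneg (norm_nonneg z) γ
    norm_num
    calc _ = -γ * 2 * (‖z‖ ^ (γ - 2) * ‖z‖ ^ 2) := by ring
      _ ≤ _ := by rw [h3]; nlinarith
  · intro z _
    have h4 := (abs_le_kap_of_sq h h2 z).2.2
    norm_num
    linarith

lemma abar_weak_div (h : -3 < γ) (h2 : γ < -2) (j : Fin 3) (G : SchwartzMap V3 ℝ) :
    Integrable (fun v => (∑ i, abar γ v i j * pd i G v) + bbar γ v j * G v) ∧
      ∫ v, ((∑ i, abar γ v i j * pd i G v) + bbar γ v j * G v) = 0 :=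
  integral_conv_weak_div (C := 6) h (by linarith) (by norm_num) (fun i => measurable_aker γ i j)
    (measurable_bker γ j) (fun i z => abs_aker_le h h2 i j z) (abs_bker_le h h2 j) G
    (integral_aker_weak_div h h2 j G)

lemma bbar_weak_div (h : -3 < γ) (h2 : γ < -2) (G : SchwartzMap V3 ℝ) :
    Integrable (fun v => (∑ i, bbar γ v i * pd i G v) + cbar γ v * G v) ∧
      ∫ v, ((∑ i, bbar γ v i * pd i G v) + cbar γ v * G v) = 0 := by
  simp only [cbar_eq]
  exact integral_conv_weak_div (C := 6) h (by linarith) (by norm_num) (measurable_bker γ)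
    (measurable_cker γ) (fun i z => abs_bker_le h h2 i z) (abs_cker_le h h2) G
    (integral_bker_weak_div h h2 G)

end

lemma pd_jap_rpow (s : ℝ) (v : V3) (i : Fin 3) :
    pd i (fun x => jap x ^ s) v = s * v i * jap v ^ (s - 2) := by
  simp only [jap_rpow_eq]
  rw [pd_add_norm_sq_rpow one_pos, show s / 2 - 1 = (s - 2) / 2 by ring]
  ring

lemma differentiableAt_jap_rpow (s : ℝ) (v : V3) :
    DifferentiableAt ℝ (fun x => jap x ^ s) v := by
  simp only [jap_rpow_eq]
  exact (hasFDerivAt_add_norm_sq_rpow one_pos (s / 2) v).differentiableAt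

lemma hasTemperateGrowth_jap_rpow (s : ℝ) : Function.HasTemperateGrowth fun v : V3 => jap v ^ s := by
  simp only [jap_rpow_eq]
  exact hasTemperateGrowth_add_norm_sq_rpow one_pos (s / 2)

lemma jap_rpow_sub_two (s : ℝ) (v : V3) : jap v ^ (s - 2) = jap v ^ s * (jap v ^ 2)⁻¹ := by
  rw [Real.rpow_sub (jap_pos v)]; norm_cast

lemma pd_jap_rpow_div (k : ℝ) (v : V3) (i : Fin 3) :
    pd i (fun x => jap x ^ k) v / jap v ^ k = k * v i * (jap v ^ 2)⁻¹ := by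
  have := Real.rpow_pos_of_pos (jap_pos v) k
  rw [pd_jap_rpow, jap_rpow_sub_two]
  field_simp

lemma pd_pd_jap_rpow_div (k : ℝ) (v : V3) (i j : Fin 3) :
    pd i (pd j fun x => jap x ^ k) v / jap v ^ k
      = k * (if i = j then 1 else 0) * (jap v ^ 2)⁻¹
        + k * (k - 2) * v i * v j * (jap v ^ 2)⁻¹ ^ 2 := by
  have := Real.rpow_pos_of_pos (jap_pos v) k
  have h1 : (pd j fun x => jap x ^ k) = fun x => k * (x j * jap x ^ (k - 2)) := by
    funext x; rw [pd_jap_rpow]; ring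
  rw [h1, pd_const_mul (f := fun x => x j * jap x ^ (k - 2)) ((differentiableAt_coord j v).mul (differentiableAt_jap_rpow _ v)),
    pd_mul (differentiableAt_coord j v) (differentiableAt_jap_rpow _ v), pd_coord, pd_jap_rpow,
    jap_rpow_sub_two (k - 2), jap_rpow_sub_two k]
  have hj := jap_pos v
  field_simp

lemma jap_rpow_sq_eq (α : ℝ) (v : V3) : (jap v ^ α) ^ 2 = jap v ^ (2 * α) := by
  rw [← Real.rpow_natCast, ← Real.rpow_mul (jap_pos v).le]; ring_nf

/-- The quadratic form `|z × ξ|²`. -/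
def crossQ (z ξ : V3) : ℝ := ‖z‖ ^ 2 * ‖ξ‖ ^ 2 - inner ℝ z ξ ^ 2

lemma crossQ_nonneg (z ξ : V3) : 0 ≤ crossQ z ξ := by
  have := abs_real_inner_le_norm z ξ
  unfold crossQ
  rw [← mul_pow, sub_nonneg, sq_le_sq, abs_of_nonneg (a := ‖z‖ * ‖ξ‖) (by positivity)]
  exact this

lemma crossQ_le (z ξ : V3) : crossQ z ξ ≤ ‖z‖ ^ 2 * ‖ξ‖ ^ 2 := by
  unfold crossQ; have := sq_nonneg (inner ℝ z ξ); linarith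

lemma inner_eq_sum (z ξ : V3) : inner ℝ z ξ = z 0 * ξ 0 + z 1 * ξ 1 + z 2 * ξ 2 := by
  rw [PiLp.inner_apply, Fin.sum_univ_three]; simp; ring

lemma sum_aker_mul {γ : ℝ} (h2 : γ < -2) (z ξ : V3) :
    ∑ i, ∑ j, aker γ z i j * (ξ i * ξ j) = ‖z‖ ^ γ * crossQ z ξ := by
  simp only [aker_eq h2, crossQ, inner_eq_sum, Fin.sum_univ_three, norm_sq_eq_sum]
  simp
  ring

lemma sum_abar_mul {γ : ℝ} (h : -3 < γ) (h2 : γ < -2) (v ξ : V3) :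
    Integrable (fun w => ‖v - w‖ ^ γ * crossQ (v - w) ξ * gaussM w) ∧
      ∑ i, ∑ j, abar γ v i j * (ξ i * ξ j) = ∫ w, ‖v - w‖ ^ γ * crossQ (v - w) ξ * gaussM w := by
  have i1 : ∀ i j, Integrable fun w => aker γ (v - w) i j * gaussM w * (ξ i * ξ j) := fun i j =>
    (integrable_kernel_mul_gaussM h (by linarith) (measurable_aker γ i j)
      (abs_aker_le h h2 i j) v).mul_const _
  have e : (fun w => ‖v - w‖ ^ γ * crossQ (v - w) ξ * gaussM w)
      = fun w => ∑ i, ∑ j, aker γ (v - w) i j * gaussM w * (ξ i * ξ j) := by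
    funext w
    rw [← sum_aker_mul h2, Finset.sum_mul]
    refine Finset.sum_congr rfl fun i _ => ?_
    rw [Finset.sum_mul]
    exact Finset.sum_congr rfl fun j _ => by ring
  rw [e]
  refine ⟨integrable_finsetSum _ fun i _ => integrable_finsetSum _ fun j _ => i1 i j, ?_⟩
  rw [integral_finsetSum _ fun i _ => integrable_finsetSum _ fun j _ => i1 i j]
  refine Finset.sum_congr rfl fun i _ => ?_
  rw [integral_finsetSum _ fun j _ => i1 i j]
  exact Finset.sum_congr rfl fun j _ => by rw [integral_mul_const]; rfl

/-- A radial weight that minorizes `μ` and its translates' moments. -/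
def rhoM (w : V3) : ℝ := (jap w ^ 3)⁻¹ * gaussM w

lemma rhoM_pos (w : V3) : 0 < rhoM w := by
  have := jap_pos w; have := gaussM_pos w; unfold rhoM; positivity

lemma continuous_rhoM : Continuous rhoM :=
  ((continuous_jap.pow 3).inv₀ fun v => (pow_pos (jap_pos v) 3).ne').mul continuous_gaussM

lemma rhoM_le (w : V3) : rhoM w ≤ gaussM w := by
  unfold rhoM
  exact mul_le_of_le_one_left (gaussM_pos w).le (inv_le_one_of_one_le₀ (one_le_pow₀ (one_le_jap w)))

lemma continuous_crossQ (ξ : V3) : Continuous fun z => crossQ z ξ := by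
  unfold crossQ; fun_prop

lemma integrable_crossQ_sub_mul_rhoM (v ξ : V3) :
    Integrable fun w => crossQ (v - w) ξ * rhoM w := by
  refine ((integrable_jap_pow_mul_gaussM 2).const_mul (4 * jap v ^ 2 * ‖ξ‖ ^ 2)).mono'
    (((continuous_crossQ ξ).comp (continuous_const.sub continuous_id)).mul
      continuous_rhoM).aestronglyMeasurable (.of_forall fun w => ?_)
  have h1 := crossQ_nonneg (v - w) ξ
  have h2 := rhoM_pos w
  rw [Real.norm_of_nonneg (by positivity)]
  have h3 : ‖v - w‖ ^ 2 ≤ (2 * jap v * jap w) ^ 2 :=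
    pow_le_pow_left₀ (norm_nonneg _) (norm_sub_le_mul_jap v w) 2
  calc crossQ (v - w) ξ * rhoM w ≤ (2 * jap v * jap w) ^ 2 * ‖ξ‖ ^ 2 * gaussM w := by
        refine mul_le_mul ((crossQ_le _ _).trans ?_) (rhoM_le w) h2.le (by positivity)
        gcongr
    _ = _ := by ring

lemma integrable_rhoM : Integrable rhoM := by
  refine ((integrable_jap_pow_mul_gaussM 0)).mono' continuous_rhoM.aestronglyMeasurable
    (.of_forall fun w => ?_)
  rw [Real.norm_of_nonneg (rhoM_pos w).le]
  simpa using rhoM_le w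

lemma rhoM_congr {v w : V3} (h : ‖v‖ = ‖w‖) : rhoM v = rhoM w := by
  simp only [rhoM, jap, gaussM, h]

lemma integral_crossQ_sub_mul_rhoM (v ξ : V3) :
    ∫ w, crossQ (v - w) ξ * rhoM w = crossQ v ξ * (∫ w, rhoM w) + ∫ w, crossQ w ξ * rhoM w := by
  have i0 : Integrable fun w => crossQ w ξ * rhoM w := by
    refine (integrable_crossQ_sub_mul_rhoM 0 ξ).congr (.of_forall fun w => ?_)
    simp [crossQ]
  have i1 := integrable_crossQ_sub_mul_rhoM v ξ
  have i2 : Integrable fun w => crossQ (v + w) ξ * rhoM w := by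
    refine i1.comp_neg.congr (.of_forall fun w => ?_)
    simp [rhoM_congr (norm_neg w)]
  have e1 : ∫ w, crossQ (v + w) ξ * rhoM w = ∫ w, crossQ (v - w) ξ * rhoM w := by
    rw [← integral_neg_eq_self]
    congr 1; funext w
    simp [rhoM_congr (norm_neg w), sub_eq_add_neg]
  have e2 : ∫ w, (crossQ (v - w) ξ * rhoM w + crossQ (v + w) ξ * rhoM w)
      = ∫ w, (2 * (crossQ v ξ * rhoM w) + 2 * (crossQ w ξ * rhoM w)) := by
    congr 1; funext w
    simp only [crossQ, inner_eq_sum, norm_sq_eq_sum]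
    simp
    ring
  rw [integral_add i1 i2, e1, integral_add ((integrable_rhoM.const_mul _).const_mul _)
    (i0.const_mul _), integral_const_mul, integral_const_mul, integral_const_mul] at e2
  linarith

lemma crossQ_smul (c : ℝ) (z ξ : V3) : crossQ z (c • ξ) = c ^ 2 * crossQ z ξ := by
  simp only [crossQ, norm_smul, inner_smul_right, mul_pow, Real.norm_eq_abs, sq_abs]
  ring

lemma integral_crossQ_mul_rhoM {e : V3} (he : ‖e‖ = 1) (ξ : V3) :
    ∫ w, crossQ w ξ * rhoM w = (∫ w, crossQ w e * rhoM w) * ‖ξ‖ ^ 2 := by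
  have hn : ‖ξ‖ = ‖‖ξ‖ • e‖ := by rw [norm_smul, he]; simp
  set U := (Submodule.span ℝ {ξ - ‖ξ‖ • e})ᗮ.reflection
  have hU : U ξ = ‖ξ‖ • e := Submodule.reflection_sub hn
  have := U.measurePreserving.integral_comp' (f := U.toHomeomorph.toMeasurableEquiv)
    (fun w => crossQ w (‖ξ‖ • e) * rhoM w)
  simp only [crossQ_smul] at this
  rw [mul_comm, ← integral_const_mul]
  simp only [← mul_assoc]
  rw [← this]
  congr 1; funext w
  have h1 : ‖U w‖ = ‖w‖ := U.norm_map w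
  have h2 : crossQ (U w) (U ξ) = crossQ w ξ := by
    simp [crossQ]
  rw [hU, crossQ_smul] at h2
  change _ = ‖ξ‖ ^ 2 * crossQ (U w) e * rhoM (U w)
  rw [h2, rhoM_congr h1]

lemma exists_abar_lower {γ : ℝ} (h : -3 < γ) (h2 : γ < -2) :
    ∃ c > 0, ∀ v ξ : V3, c * jap v ^ γ * (crossQ v ξ + ‖ξ‖ ^ 2)
      ≤ ∑ i, ∑ j, abar γ v i j * (ξ i * ξ j) := by
  let e : V3 := EuclideanSpace.single 0 1
  have he : ‖e‖ = 1 := by simp [e]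
  set c0 := ∫ w, rhoM w
  set s := ∫ w, crossQ w e * rhoM w
  have hc0 : 0 < c0 := integral_pos_of_integrable_nonneg_nonzero (x := 0) continuous_rhoM
    integrable_rhoM (fun w => (rhoM_pos w).le) (rhoM_pos 0).ne'
  have hs : 0 < s := by
    refine integral_pos_of_integrable_nonneg_nonzero (x := EuclideanSpace.single 1 1)
      ((continuous_crossQ e).mul continuous_rhoM) ?_
      (fun w => mul_nonneg (crossQ_nonneg w e) (rhoM_pos w).le) ?_
    · refine (integrable_crossQ_sub_mul_rhoM 0 e).congr (.of_forall fun w => ?_)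
      simp [crossQ]
    · refine mul_ne_zero ?_ (rhoM_pos _).ne'
      simp [crossQ, e, inner_eq_sum]
  refine ⟨1 / 8 * min c0 s, by positivity, fun v ξ => ?_⟩
  obtain ⟨hint, heq⟩ := sum_abar_mul h h2 v ξ
  have hj := Real.rpow_nonneg (jap_pos v).le γ
  have hQ := crossQ_nonneg v ξ
  have h0 : (volume : Measure V3) {v} = 0 := by simp
  have key : ∫ w, 1 / 8 * jap v ^ γ * (crossQ (v - w) ξ * rhoM w)
      ≤ ∫ w, ‖v - w‖ ^ γ * crossQ (v - w) ξ * gaussM w := by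
    refine integral_mono_ae ((integrable_crossQ_sub_mul_rhoM v ξ).const_mul _) hint ?_
    filter_upwards [compl_mem_ae_iff.mpr h0] with w hw
    have hne : v ≠ w := fun h => hw (by simp [h])
    have h3 := le_norm_sub_rpow h.le (by linarith) hne
    have h4 := mul_le_mul_of_nonneg_right h3
      (mul_nonneg (crossQ_nonneg (v - w) ξ) (gaussM_pos w).le)
    unfold rhoM
    linarith
  rw [heq]
  refine le_trans ?_ key
  rw [integral_const_mul, integral_crossQ_sub_mul_rhoM, integral_crossQ_mul_rhoM he]
  have h5 : min c0 s * (crossQ v ξ + ‖ξ‖ ^ 2) ≤ crossQ v ξ * c0 + s * ‖ξ‖ ^ 2 := by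
    have := mul_le_mul_of_nonneg_right (min_le_left c0 s) hQ
    have := mul_le_mul_of_nonneg_right (min_le_right c0 s) (sq_nonneg ‖ξ‖)
    linarith
  have := mul_le_mul_of_nonneg_left h5 (mul_nonneg (by norm_num : (0:ℝ) ≤ 1 / 8) hj)
  linarith

lemma gradient_apply {f : V3 → ℝ} {v : V3} (i : Fin 3) : gradient f v i = pd i f v := by
  unfold pd gradient
  rw [← InnerProductSpace.toDual_symm_apply, EuclideanSpace.inner_single_right]
  simp

lemma norm_anisoGrad_sq (f : V3 → ℝ) (v : V3) :
    ‖anisoGrad f v‖ ^ 2 = crossQ v (gradient f v) + ‖gradient f v‖ ^ 2 := by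
  set ξ := gradient f v with hξ
  have h1 : anisoGrad f v = Pv v ξ + jap v • (ξ - Pv v ξ) := rfl
  have hj := jap_sq v
  have hs : ∑ i, ξ i * v i = inner ℝ v ξ := by rw [inner_eq_sum, Fin.sum_univ_three]; ring
  rw [h1, Pv, hs]
  rcases eq_or_ne v 0 with rfl | hv
  · simp [crossQ, jap]
  · have hv : 0 < ‖v‖ := norm_pos_iff.mpr hv
    set c := inner ℝ v ξ / ‖v‖ ^ 2 with hc
    have hcv : inner ℝ v ξ = c * ‖v‖ ^ 2 := by rw [hc]; field_simp
    rw [norm_add_sq_real, inner_smul_left, inner_smul_right, inner_sub_right, inner_smul_right,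
      real_inner_self_eq_norm_sq, hcv, norm_smul, norm_smul, mul_pow, mul_pow, norm_sub_sq_real,
      inner_smul_right, real_inner_comm v ξ, hcv, norm_smul]
    simp only [crossQ, hcv, mul_pow, Real.norm_eq_abs, sq_abs, hj]
    simp
    ring

lemma sum_abar_diag {γ : ℝ} (h : -3 < γ) (h2 : γ < -2) (v : V3) :
    Integrable (fun w => ‖v - w‖ ^ γ * (2 * ‖v - w‖ ^ 2) * gaussM w) ∧
      ∑ i, abar γ v i i = ∫ w, ‖v - w‖ ^ γ * (2 * ‖v - w‖ ^ 2) * gaussM w := by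
  have i1 : ∀ i, Integrable fun w => aker γ (v - w) i i * gaussM w := fun i =>
    integrable_kernel_mul_gaussM h (by linarith) (measurable_aker γ i i) (abs_aker_le h h2 i i) v
  have e : (fun w => ‖v - w‖ ^ γ * (2 * ‖v - w‖ ^ 2) * gaussM w)
      = fun w => ∑ i, aker γ (v - w) i i * gaussM w := by
    funext w
    simp only [aker_eq h2, Fin.sum_univ_three, norm_sq_eq_sum]
    simp
    ring
  rw [e]
  exact ⟨integrable_finsetSum _ fun i _ => i1 i, (integral_finsetSum _ fun i _ => i1 i).symm⟩

lemma sum_bbar_mul {γ : ℝ} (h : -3 < γ) (h2 : γ < -2) (v ξ : V3) :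
    Integrable (fun w => ‖v - w‖ ^ γ * (-2 * inner ℝ (v - w) ξ) * gaussM w) ∧
      ∑ i, bbar γ v i * ξ i = ∫ w, ‖v - w‖ ^ γ * (-2 * inner ℝ (v - w) ξ) * gaussM w := by
  have i1 : ∀ i, Integrable fun w => bker γ (v - w) i * gaussM w * ξ i := fun i =>
    (integrable_kernel_mul_gaussM h (by linarith) (measurable_bker γ i)
      (abs_bker_le h h2 i) v).mul_const _
  have e : (fun w => ‖v - w‖ ^ γ * (-2 * inner ℝ (v - w) ξ) * gaussM w)
      = fun w => ∑ i, bker γ (v - w) i * gaussM w * ξ i := by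
    funext w
    simp only [bker_eq, Fin.sum_univ_three, inner_eq_sum]
    ring
  rw [e]
  refine ⟨integrable_finsetSum _ fun i _ => i1 i, ?_⟩
  rw [integral_finsetSum _ fun i _ => i1 i]
  exact Finset.sum_congr rfl fun i _ => by rw [integral_mul_const]; rfl

lemma crossQ_sub_right (v w : V3) : crossQ (v - w) v = crossQ (v - w) w := by
  simp only [crossQ, inner_eq_sum, norm_sq_eq_sum]
  simp
  ring

/-- The zeroth-order coefficient of the quadratic form of `B*_m` in `L²(⟨v⟩^{2α})`. -/
def zeroCoef (γ k α : ℝ) (v : V3) : ℝ :=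
  α * (jap v ^ 2)⁻¹ * (∑ i, abar γ v i i) + k * (jap v ^ 2)⁻¹ * (∑ i, bbar γ v i * v i)
    + (k * (k - 2) - (k - α) * (2 * α - 2)) * (jap v ^ 2)⁻¹ ^ 2
      * (∑ i, ∑ j, abar γ v i j * (v i * v j))
    - cbar γ v / 2

lemma zeroCoef_kernel_le {γ : ℝ} (k α : ℝ) (h : -3 < γ) (h2 : γ < -2)
    (hα : α < k - (γ + 3) / 2) (N : ℝ) {v w : V3} (hne : v ≠ w) :
    ‖v - w‖ ^ γ * (α * (jap v ^ 2)⁻¹ * (2 * ‖v - w‖ ^ 2)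
        + k * (jap v ^ 2)⁻¹ * (-2 * inner ℝ (v - w) v)
        + N * (jap v ^ 2)⁻¹ ^ 2 * crossQ (v - w) v + (γ + 3))
      ≤ -((2 * k - 2 * α - (γ + 3)) / 8) * jap v ^ γ * (jap w ^ 3)⁻¹
        + 64 * (|-2 * k + 2 * (γ + 3)| + (γ + 3) + |N|) * jap v ^ (γ - 1)
          * (jap w ^ 5 * kap γ (v - w)) := by
  have hJ1 := one_le_jap v
  have hw1 := one_le_jap w
  have hnw := norm_le_jap w
  have hw0 := norm_nonneg w
  have hwsq := jap_sq w
  have hvsq := jap_sq v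
  have hz : 0 < ‖v - w‖ := norm_pos_iff.mpr (sub_ne_zero.mpr hne)
  have hl := le_norm_sub_rpow (β := γ + 2) (by linarith) (by linarith) hne
  have u0 := norm_sub_rpow_le (β := γ) h.le le_rfl (by linarith) v w
  have u1 := norm_sub_rpow_le (β := γ + 1) h.le (by linarith) (by linarith) v w
  have u2 := norm_sub_rpow_le (β := γ + 2) h.le (by linarith) (by linarith) v w
  have hc4 := crossQ_nonneg (v - w) w
  have hc4' := crossQ_le (v - w) w
  have hin := abs_real_inner_le_norm (v - w) w
  have hv0 : ‖v‖ ^ 2 = ‖v - w‖ ^ 2 + 2 * inner ℝ (v - w) w + ‖w‖ ^ 2 := by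
    simp only [inner_eq_sum, norm_sq_eq_sum]; simp; ring
  have hin0 : inner ℝ (v - w) v = ‖v - w‖ ^ 2 + inner ℝ (v - w) w := by
    simp only [inner_eq_sum, norm_sq_eq_sum]; simp; ring
  have hJ := jap_pos v
  have e0 : jap v ^ γ = jap v ^ (γ - 1) * jap v := by
    rw [← Real.rpow_add_one hJ.ne']; ring_nf
  have e1 : jap v ^ (γ + 1) = jap v ^ (γ - 1) * jap v ^ 2 := by
    rw [Real.rpow_add_one hJ.ne', e0]; ring
  have e2 : jap v ^ (γ + 2) = jap v ^ (γ - 1) * jap v ^ 3 := by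
    rw [show γ + 2 = γ + 1 + 1 by ring, Real.rpow_add_one hJ.ne', e1]; ring
  have z1 : ‖v - w‖ ^ (γ + 1) = ‖v - w‖ ^ γ * ‖v - w‖ := Real.rpow_add_one hz.ne' γ
  have z2 : ‖v - w‖ ^ (γ + 2) = ‖v - w‖ ^ γ * ‖v - w‖ ^ 2 := by
    rw [show γ + 2 = γ + 1 + 1 by ring, Real.rpow_add_one hz.ne', z1]; ring
  rw [e0] at u0 ⊢
  rw [e1, z1] at u1
  rw [e2, z2] at u2 hl
  rw [crossQ_sub_right, hin0]
  have hB : 0 ≤ jap v ^ (γ - 1) := Real.rpow_nonneg hJ.le _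
  have hK := kap_nonneg γ (v - w)
  have hp : 0 ≤ ‖v - w‖ ^ γ := Real.rpow_nonneg hz.le _
  generalize inner ℝ (v - w) w = s at *
  generalize crossQ (v - w) w = Q at *
  generalize kap γ (v - w) = κ at *
  generalize ‖v - w‖ ^ γ = p at *
  generalize ‖v - w‖ = n at *
  generalize jap v ^ (γ - 1) = B at *
  generalize ‖w‖ = a at *
  generalize ‖v‖ = b at *
  generalize jap v = J at *
  generalize jap w = j at *
  have hq : (J ^ 2)⁻¹ * (1 + b ^ 2) = 1 := by rw [← hvsq]; field_simp
  have hqJ : (J ^ 2)⁻¹ * J ^ 2 = 1 := by field_simp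
  have hq0 : 0 ≤ (J ^ 2)⁻¹ := by positivity
  generalize (J ^ 2)⁻¹ = q at *
  have hqJ1 : q * J ≤ 1 := by rw [← hqJ]; gcongr; nlinarith
  have hE : 0 ≤ B * j ^ 5 * κ := by positivity
  have hj45 : B * j ^ 4 * κ ≤ B * j ^ 5 * κ := by gcongr; norm_num
  have a0 : 0 ≤ a ^ 2 := sq_nonneg a
  -- the three error terms
  have t2 : p * (q * |s|) ≤ 64 * (B * j ^ 5 * κ) := by
    calc p * (q * |s|) ≤ p * (q * (n * j)) := by
          gcongr; exact hin.trans (by gcongr)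
      _ = q * j * (p * n) := by ring
      _ ≤ q * j * (64 * (B * J ^ 2) * j ^ 3 * κ) := by gcongr
      _ = 64 * (B * j ^ 4 * κ) * (q * J ^ 2) := by ring
      _ ≤ _ := by rw [hqJ]; linarith
  have t3 : p * (q * j ^ 2) ≤ 64 * (B * j ^ 5 * κ) := by
    calc p * (q * j ^ 2) ≤ 64 * (B * J) * j ^ 3 * κ * (q * j ^ 2) := by gcongr
      _ = 64 * (B * j ^ 5 * κ) * (q * J) := by ring
      _ ≤ 64 * (B * j ^ 5 * κ) * 1 := by gcongr
      _ = _ := by ring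
  have t4 : p * (q ^ 2 * Q) ≤ 64 * (B * j ^ 5 * κ) := by
    calc p * (q ^ 2 * Q) ≤ p * (q ^ 2 * (n ^ 2 * j ^ 2)) := by
          gcongr; exact hc4'.trans (by gcongr)
      _ = q ^ 2 * j ^ 2 * (p * n ^ 2) := by ring
      _ ≤ q ^ 2 * j ^ 2 * (64 * (B * J ^ 3) * j ^ 3 * κ) := by gcongr
      _ = 64 * (B * j ^ 5 * κ) * (q * J) * (q * J ^ 2) := by ring
      _ ≤ 64 * (B * j ^ 5 * κ) * 1 * 1 := by rw [hqJ]; gcongr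
      _ = _ := by ring
  have t1 : 1 / 8 * (B * J) * (j ^ 3)⁻¹ ≤ p * (q * n ^ 2) := by
    calc 1 / 8 * (B * J) * (j ^ 3)⁻¹ = 1 / 8 * (B * J) * (j ^ 3)⁻¹ * (q * J ^ 2) := by
          rw [hqJ, mul_one]
      _ = q * (1 / 8 * (B * J ^ 3) * (j ^ 3)⁻¹) := by ring
      _ ≤ q * (p * n ^ 2) := by gcongr
      _ = _ := by ring
  have id : p * (α * q * (2 * n ^ 2) + k * q * (-2 * (n ^ 2 + s)) + N * q ^ 2 * Q + (γ + 3))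
      = -(2 * k - 2 * α - (γ + 3)) * (p * (q * n ^ 2)) + (-2 * k + 2 * (γ + 3)) * s * (p * q)
        + (γ + 3) * (p * (q * j ^ 2)) + N * (p * (q ^ 2 * Q)) := by
    rw [hv0] at hq
    rw [hwsq]
    linear_combination (-p * (γ + 3)) * hq
  rw [id]
  have s2 : (-2 * k + 2 * (γ + 3)) * s * (p * q)
      ≤ |-2 * k + 2 * (γ + 3)| * (64 * (B * j ^ 5 * κ)) := by
    calc _ ≤ |(-2 * k + 2 * (γ + 3)) * s| * (p * q) := by gcongr; exact le_abs_self _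
      _ = |-2 * k + 2 * (γ + 3)| * (p * (q * |s|)) := by rw [abs_mul]; ring
      _ ≤ _ := by gcongr
  have s4 : N * (p * (q ^ 2 * Q)) ≤ |N| * (64 * (B * j ^ 5 * κ)) := by
    calc _ ≤ |N| * (p * (q ^ 2 * Q)) := by gcongr; exact le_abs_self _
      _ ≤ _ := by gcongr
  have s3 := mul_le_mul_of_nonneg_left t3 (show 0 ≤ γ + 3 by linarith)
  have s1 := mul_le_mul_of_nonneg_left t1 (show 0 ≤ 2 * k - 2 * α - (γ + 3) by linarith)
  linarith

lemma exists_zeroCoef_le {γ k α : ℝ} (h : -3 < γ) (h2 : γ < -2)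
    (hα : α < k - (γ + 3) / 2) :
    ∃ l > 0, ∃ C, 0 ≤ C ∧ ∀ v, zeroCoef γ k α v ≤ -l * jap v ^ γ + C * jap v ^ (γ - 1) := by
  obtain ⟨D, hD0, hD⟩ := exists_kap_conv_bound h (by linarith) 5
  have hc0 : 0 < ∫ w, rhoM w := integral_pos_of_integrable_nonneg_nonzero (x := 0)
    continuous_rhoM integrable_rhoM (fun w => (rhoM_pos w).le) (rhoM_pos 0).ne'
  set N := k * (k - 2) - (k - α) * (2 * α - 2) with hN
  have hE : 0 ≤ 64 * (|-2 * k + 2 * (γ + 3)| + (γ + 3) + |N|) := by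
    have : 0 < γ + 3 := by linarith
    positivity
  set E := 64 * (|-2 * k + 2 * (γ + 3)| + (γ + 3) + |N|) with hEdef
  have hl : 0 < (2 * k - 2 * α - (γ + 3)) / 8 := by linarith
  set l := (2 * k - 2 * α - (γ + 3)) / 8 with hldef
  refine ⟨l * ∫ w, rhoM w, by positivity, E * D, by positivity, fun v => ?_⟩
  obtain ⟨ia, ea⟩ := sum_abar_diag h h2 v
  obtain ⟨ib, eb⟩ := sum_bbar_mul h h2 v v
  obtain ⟨iq, eq⟩ := sum_abar_mul h h2 v v
  have ic := integrable_kernel_mul_gaussM h (by linarith) (measurable_cker γ) (abs_cker_le h h2) v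
  have hint := (((ia.const_mul (α * (jap v ^ 2)⁻¹)).add (ib.const_mul (k * (jap v ^ 2)⁻¹))).add
    (iq.const_mul (N * (jap v ^ 2)⁻¹ ^ 2))).sub (ic.div_const 2)
  have hZ : zeroCoef γ k α v = ∫ w, ((((fun w : V3 => α * (jap v ^ 2)⁻¹
        * (‖v - w‖ ^ γ * (2 * ‖v - w‖ ^ 2) * gaussM w))
      + (fun w : V3 => k * (jap v ^ 2)⁻¹ * (‖v - w‖ ^ γ * (-2 * inner ℝ (v - w) v) * gaussM w))
      + (fun w : V3 => N * (jap v ^ 2)⁻¹ ^ 2 * (‖v - w‖ ^ γ * crossQ (v - w) v * gaussM w)))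
      - (fun w : V3 => cker γ (v - w) * gaussM w / 2)) : V3 → ℝ) w := by
    rw [integral_sub' (((ia.const_mul _).add (ib.const_mul _)).add (iq.const_mul _))
      (ic.div_const 2), integral_add' ((ia.const_mul _).add (ib.const_mul _)) (iq.const_mul _),
      integral_add' (ia.const_mul _) (ib.const_mul _), integral_const_mul, integral_const_mul,
      integral_const_mul, integral_div, zeroCoef, ea, eb, eq, cbar_eq]
  have hr : Integrable fun w => -l * jap v ^ γ * rhoM w
      + E * jap v ^ (γ - 1) * (jap w ^ 5 * kap γ (v - w) * gaussM w) :=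
    (integrable_rhoM.const_mul _).add ((hD v).1.const_mul _)
  have h0 : (volume : Measure V3) {v} = 0 := by simp
  rw [hZ]
  refine (integral_mono_ae hint hr ?_).trans ?_
  · filter_upwards [compl_mem_ae_iff.mpr h0] with w hw
    have hne : v ≠ w := fun h => hw (by simp [h])
    have key := mul_le_mul_of_nonneg_right (zeroCoef_kernel_le k α h h2 hα N hne) (gaussM_pos w).le
    rw [← hEdef, ← hldef] at key
    simp only [Pi.add_apply, Pi.sub_apply, cker, rhoM]
    linarith
  · rw [integral_add (integrable_rhoM.const_mul _) ((hD v).1.const_mul _), integral_const_mul,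
      integral_const_mul]
    have := mul_le_mul_of_nonneg_left (hD v).2
      (mul_nonneg hE (Real.rpow_nonneg (jap_pos v).le (γ - 1)))
    linarith

/-- A cutoff at a large radius makes the zeroth-order coefficient uniformly negative. -/
lemma exists_zeroCoef_sub_cutoff_le {γ k α : ℝ} (h : -3 < γ) (h2 : γ < -2)
    (hα : α < k - (γ + 3) / 2) {χ : V3 → ℝ} (hχ0 : ∀ v, 0 ≤ χ v)
    (hχ1 : ∀ v : V3, ‖v‖ ≤ 1 → χ v = 1) :
    ∃ l > (0 : ℝ), ∃ M > (0 : ℝ), ∃ R > (0 : ℝ), ∀ v,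
      zeroCoef γ k α v - M * χ (R⁻¹ • v) ≤ -l * jap v ^ γ := by
  obtain ⟨l, hl, C, hC, hZ⟩ := exists_zeroCoef_le (k := k) h h2 hα
  have hR : 0 < max (2 * C / l) 1 := lt_of_lt_of_le one_pos (le_max_right _ _)
  set R := max (2 * C / l) 1 with hRdef
  refine ⟨l / 2, by positivity, C + 1, by positivity, R, hR, fun v => ?_⟩
  have hJ := jap_pos v
  have hJg : 0 ≤ jap v ^ γ := Real.rpow_nonneg hJ.le _
  rcases le_total ‖v‖ R with hv | hv
  · have : χ (R⁻¹ • v) = 1 := by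
      apply hχ1
      rw [norm_smul, norm_inv, Real.norm_of_nonneg hR.le, inv_mul_le_iff₀ hR]
      linarith
    rw [this]
    have h3 := Real.rpow_le_one_of_one_le_of_nonpos (one_le_jap v) (show γ - 1 ≤ 0 by linarith)
    have := mul_le_mul_of_nonneg_left h3 hC
    have := mul_nonneg hl.le hJg
    linarith [hZ v]
  · have h3 : 2 * C / l ≤ jap v := ((le_max_left _ _).trans hv).trans (norm_le_jap v)
    have h4 : C ≤ l / 2 * jap v := by
      rw [div_le_iff₀ hl] at h3; linarith
    have e0 : jap v ^ γ = jap v ^ (γ - 1) * jap v := by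
      rw [← Real.rpow_add_one hJ.ne']; ring_nf
    have h5 := mul_le_mul_of_nonneg_right h4 (Real.rpow_nonneg hJ.le (γ - 1))
    have := mul_nonneg (show 0 ≤ C + 1 by positivity) (hχ0 (R⁻¹ • v))
    have := hZ v
    nlinarith

lemma abar_symm {γ : ℝ} (v : V3) (i j : Fin 3) : abar γ v i j = abar γ v j i := by
  simp only [abar, aker, eq_comm (a := i) (b := j), mul_comm]

lemma hasTemperateGrowth_inv_jap_sq : Function.HasTemperateGrowth fun v : V3 => (jap v ^ 2)⁻¹ := by
  convert hasTemperateGrowth_jap_rpow (-2) using 2 with v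
  rw [Real.rpow_neg (jap_pos v).le]; norm_cast

section

variable {γ : ℝ} {g : V3 → ℝ}

lemma integrable_temperate_mul (hg : g.HasTemperateGrowth) (G : SchwartzMap V3 ℝ) :
    Integrable fun v => g v * G v := by
  obtain ⟨F, hF⟩ := exists_schwartz_mul hg G
  simpa only [← hF] using F.integrable

lemma integrable_abar_mul (h : -3 < γ) (h2 : γ < -2) (i j : Fin 3) (hg : g.HasTemperateGrowth)
    (G : SchwartzMap V3 ℝ) : Integrable fun v => abar γ v i j * (g v * G v) := by
  obtain ⟨F, hF⟩ := exists_schwartz_mul hg G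
  simp only [← hF]
  exact integrable_conv_mul_schwartz h (by linarith) (measurable_aker γ i j)
    (by norm_num) (abs_aker_le h h2 i j) F

lemma integrable_bbar_mul (h : -3 < γ) (h2 : γ < -2) (i : Fin 3) (hg : g.HasTemperateGrowth)
    (G : SchwartzMap V3 ℝ) : Integrable fun v => bbar γ v i * (g v * G v) := by
  obtain ⟨F, hF⟩ := exists_schwartz_mul hg G
  simp only [← hF]
  exact integrable_conv_mul_schwartz h (by linarith) (measurable_bker γ i)
    (by norm_num) (abs_bker_le h h2 i) F

lemma integrable_cbar_mul (h : -3 < γ) (h2 : γ < -2) (hg : g.HasTemperateGrowth)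
    (G : SchwartzMap V3 ℝ) : Integrable fun v => cbar γ v * (g v * G v) := by
  obtain ⟨F, hF⟩ := exists_schwartz_mul hg G
  simpa only [← hF, cbar_eq] using integrable_conv_mul_schwartz h (by linarith)
    (measurable_cker γ) (by norm_num) (abs_cker_le h h2) F

lemma integrable_zeroCoef_mul (k α : ℝ) (h : -3 < γ) (h2 : γ < -2) (hg : g.HasTemperateGrowth)
    (G : SchwartzMap V3 ℝ) : Integrable fun v => zeroCoef γ k α v * (g v * G v) := by
  have hq := hasTemperateGrowth_inv_jap_sq
  have i1 := (integrable_finsetSum Finset.univ fun i _ =>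
    integrable_abar_mul h h2 i i (hq.mul hg) G).const_mul α
  have i2 := (integrable_finsetSum Finset.univ fun i _ =>
    integrable_bbar_mul h h2 i ((hasTemperateGrowth_coord i).mul (hq.mul hg)) G).const_mul k
  have i3 := (integrable_finsetSum Finset.univ fun i _ => integrable_finsetSum Finset.univ
    fun j _ => integrable_abar_mul h h2 i j (((hasTemperateGrowth_coord i).mul
      (hasTemperateGrowth_coord j)).mul ((hq.mul hq).mul hg)) G).const_mul
        (k * (k - 2) - (k - α) * (2 * α - 2))
  have i4 := (integrable_cbar_mul h h2 hg G).div_const 2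
  refine (((i1.add i2).add i3).sub i4).congr (.of_forall fun v => ?_)
  simp only [zeroCoef, Pi.add_apply, Pi.sub_apply, Pi.mul_apply, Fin.sum_univ_three]
  ring

end

lemma exists_bstar_weak_form {γ : ℝ} (k α M R : ℝ) (χ : V3 → ℝ) (h : -3 < γ) (h2 : γ < -2)
    (φ : SchwartzMap V3 ℝ) :
    ∃ T : V3 → ℝ, Integrable T ∧ ∫ v, T v = 0 ∧ ∀ v,
      BstarOp γ (fun w => jap w ^ k) M R χ φ v * φ v * (jap v ^ α) ^ 2
        = T v + ((zeroCoef γ k α v - M * χ (R⁻¹ • v)) * φ v ^ 2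
          - ∑ i, ∑ j, abar γ v i j * (pd i φ v * pd j φ v)) * (jap v ^ α) ^ 2 := by
  choose P hP using exists_schwartz_pd φ
  have hP' : ∀ i, pd i φ = P i := fun i => (funext (hP i)).symm
  obtain ⟨ψ, hψ⟩ := exists_schwartz_mul (hasTemperateGrowth_jap_rpow (2 * α)) φ
  obtain ⟨θ, hθ⟩ := exists_schwartz_mul (hasTemperateGrowth_jap_rpow (2 * α - 2)) φ
  choose G₁ hG₁ using fun j => exists_schwartz_mul ψ.hasTemperateGrowth (P j)
  obtain ⟨G₂, hG₂⟩ := exists_schwartz_mul φ.hasTemperateGrowth ψ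
  choose G₃ hG₃ using fun j => exists_schwartz_mul
    ((hasTemperateGrowth_coord j).mul φ.hasTemperateGrowth) θ
  simp only [Pi.mul_apply] at hG₃
  have a₁ := fun j => abar_weak_div h h2 j (G₁ j)
  have a₂ := bbar_weak_div h h2 G₂
  have a₃ := fun j => abar_weak_div h h2 j (G₃ j)
  have I₁ := integrable_finsetSum Finset.univ fun j _ => (a₁ j).1
  have I₂ := a₂.1.const_mul (1 / 2)
  have I₃ := (integrable_finsetSum Finset.univ fun j _ => (a₃ j).1).const_mul (k - α)
  refine ⟨_, (I₁.add I₂).add I₃, ?_, fun v => ?_⟩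
  · rw [integral_add' (I₁.add I₂) I₃, integral_add' I₁ I₂, integral_const_mul, integral_const_mul,
      integral_finsetSum _ fun j _ => (a₁ j).1, integral_finsetSum _ fun j _ => (a₃ j).1]
    simp [a₁, a₂, a₃]
  have dφ := φ.differentiableAt (x := v)
  have dP : ∀ i, DifferentiableAt ℝ (P i) v := fun i => (P i).differentiableAt
  have dψ := ψ.differentiableAt (x := v)
  have dθ := θ.differentiableAt (x := v)
  have pψ : ∀ i, pd i ψ v = 2 * α * v i * (jap v ^ 2)⁻¹ * ψ v + jap v ^ (2 * α) * P i v := by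
    intro i
    rw [funext hψ, pd_mul (differentiableAt_jap_rpow _ v) dφ, pd_jap_rpow, jap_rpow_sub_two, hP']
    ring
  have pθ : ∀ i, pd i θ v
      = (2 * α - 2) * v i * (jap v ^ 2)⁻¹ * θ v + jap v ^ (2 * α - 2) * P i v := by
    intro i
    rw [funext hθ, pd_mul (differentiableAt_jap_rpow _ v) dφ, pd_jap_rpow,
      jap_rpow_sub_two (2 * α - 2), hP']
    ring
  have p₁ : ∀ i j, pd i (G₁ j) v = pd i ψ v * P j v + ψ v * pd i (P j) v := fun i j => by
    rw [funext (hG₁ j), pd_mul dψ (dP j)]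
  have p₂ : ∀ i, pd i G₂ v = P i v * ψ v + φ v * pd i ψ v := fun i => by
    rw [funext hG₂, pd_mul dφ dψ, hP']
  have p₃ : ∀ i j, pd i (G₃ j) v
      = ((if i = j then 1 else 0) * φ v + v j * P i v) * θ v + v j * φ v * pd i θ v := fun i j => by
    rw [funext (hG₃ j), pd_mul (f := fun x => x j * φ x) ((differentiableAt_coord j v).mul dφ) dθ,
      pd_mul (differentiableAt_coord j v) dφ, pd_coord, hP']
  simp only [BstarOp, hP', mul_div_assoc, pd_jap_rpow_div, pd_pd_jap_rpow_div, zeroCoef,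
    Pi.add_apply, p₁, p₂, p₃, pψ, pθ, hG₁, hG₂, hG₃, hψ, hθ, jap_rpow_sub_two (2 * α),
    jap_rpow_sq_eq]
  generalize jap v ^ (2 * α) = W
  generalize (jap v ^ 2)⁻¹ = q
  simp only [Fin.sum_univ_three, abar_symm v 1 0, abar_symm v 2 0, abar_symm v 2 1]
  simp
  ring

lemma integrable_weighted_sq (γ α : ℝ) (φ : SchwartzMap V3 ℝ) :
    Integrable fun v => jap v ^ γ * φ v ^ 2 * (jap v ^ α) ^ 2 := by
  refine (integrable_temperate_mul (((hasTemperateGrowth_jap_rpow γ).mul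
    (hasTemperateGrowth_jap_rpow (2 * α))).mul φ.hasTemperateGrowth) φ).congr
    (.of_forall fun v => ?_)
  simp only [jap_rpow_sq_eq, Pi.mul_apply]
  ring

lemma integrable_weighted_anisoGrad_sq (γ α : ℝ) (φ : SchwartzMap V3 ℝ) :
    Integrable fun v => jap v ^ γ * ‖anisoGrad φ v‖ ^ 2 * (jap v ^ α) ^ 2 := by
  choose P hP using exists_schwartz_pd φ
  have hJ := (hasTemperateGrowth_jap_rpow γ).mul (hasTemperateGrowth_jap_rpow (2 * α))
  have i1 := integrable_finsetSum Finset.univ fun i _ => integrable_temperate_mul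
    ((hJ.mul ((Function.HasTemperateGrowth.const 1).add
      (Function.hasTemperateGrowth_norm_sq V3))).mul (P i).hasTemperateGrowth) (P i)
  have i2 := integrable_finsetSum Finset.univ fun i _ => integrable_finsetSum Finset.univ
    fun j _ => integrable_temperate_mul ((hJ.mul ((hasTemperateGrowth_coord i).mul
      (hasTemperateGrowth_coord j))).mul (P i).hasTemperateGrowth) (P j)
  refine (i1.sub i2).congr (.of_forall fun v => ?_)
  beta_reduce
  rw [norm_anisoGrad_sq]
  simp only [crossQ, inner_eq_sum, norm_sq_eq_sum, gradient_apply, ← hP,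
    jap_rpow_sq_eq, Fin.sum_univ_three, Pi.add_apply, Pi.sub_apply, Pi.mul_apply]
  ring

lemma integrable_zeroth_sub_dirichlet {γ : ℝ} (k α M R : ℝ) {χ : V3 → ℝ} (hχ : Continuous χ)
    (hχ01 : ∀ v, χ v ∈ Set.Icc (0 : ℝ) 1) (h : -3 < γ) (h2 : γ < -2) (φ : SchwartzMap V3 ℝ) :
    Integrable fun v => ((zeroCoef γ k α v - M * χ (R⁻¹ • v)) * φ v ^ 2
      - ∑ i, ∑ j, abar γ v i j * (pd i φ v * pd j φ v)) * (jap v ^ α) ^ 2 := by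
  choose P hP using exists_schwartz_pd φ
  have hW := hasTemperateGrowth_jap_rpow (2 * α)
  have i0 := integrable_temperate_mul (hW.mul φ.hasTemperateGrowth) φ
  have i1 := integrable_zeroCoef_mul k α h h2 (hW.mul φ.hasTemperateGrowth) φ
  have i2 : Integrable fun v : V3 => χ (R⁻¹ • v) * ((fun v => jap v ^ (2 * α)) * ⇑φ) v * φ v := by
    refine i0.norm.mono' (Continuous.aestronglyMeasurable ?_) (.of_forall fun v => ?_)
    · have := continuous_jap_rpow (2 * α)
      have := φ.continuous
      simp only [Pi.mul_apply]
      fun_prop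
    · rw [mul_assoc, norm_mul, Real.norm_of_nonneg (hχ01 _).1]
      exact mul_le_of_le_one_left (norm_nonneg _) (hχ01 _).2
  have i3 := integrable_finsetSum Finset.univ fun i _ => integrable_finsetSum Finset.univ
    fun j _ => integrable_abar_mul h h2 i j (hW.mul (P i).hasTemperateGrowth) (P j)
  refine ((i1.sub (i2.const_mul M)).sub i3).congr (.of_forall fun v => ?_)
  simp only [← hP, jap_rpow_sq_eq, Fin.sum_univ_three, Pi.sub_apply, Pi.mul_apply]
  ring

/-- Lemma 2.4 (1): weak dissipativity of B*_m in L²(ω) for polynomial weights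
m = ⟨v⟩^k, ω = ⟨v⟩^α with k > (γ+3)/2 and 0 ≤ α < k − (γ+3)/2. -/
theorem stmt12 (γ k α : ℝ) (hγ : γ ∈ Set.Ioo (-3 : ℝ) (-2)) (hk : (γ + 3) / 2 < k)
    (hα0 : 0 ≤ α) (hα : α < k - (γ + 3) / 2)
    (χ : V3 → ℝ) (hχsm : ContDiff ℝ (⊤ : ℕ∞) χ) (hχ01 : ∀ v, χ v ∈ Set.Icc (0 : ℝ) 1)
    (hχ1 : ∀ v : V3, ‖v‖ ≤ 1 → χ v = 1) (hχ0 : ∀ v : V3, 2 < ‖v‖ → χ v = 0) :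
    ∃ M > (0 : ℝ), ∃ R > (0 : ℝ), ∃ C > (0 : ℝ), ∀ φ : SchwartzMap V3 ℝ,
      (∫ v : V3, BstarOp γ (fun w => jap w ^ k) M R χ (⇑φ) v * φ v * (jap v ^ α) ^ 2)
        ≤ -C * ((∫ v : V3, jap v ^ γ * φ v ^ 2 * (jap v ^ α) ^ 2)
            + (∫ v : V3, jap v ^ γ * ‖anisoGrad (⇑φ) v‖ ^ 2 * (jap v ^ α) ^ 2)) := by
  obtain ⟨l, hl, M, hM, R, hR, hZ⟩ := exists_zeroCoef_sub_cutoff_le hγ.1 hγ.2 hα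
    (fun v => (hχ01 v).1) hχ1
  obtain ⟨c, hc, hA⟩ := exists_abar_lower hγ.1 hγ.2
  refine ⟨M, hM, R, hR, min c l, lt_min hc hl, fun φ => ?_⟩
  obtain ⟨T, hT, hT0, hB⟩ := exists_bstar_weak_form k α M R χ hγ.1 hγ.2 φ
  have hU : Integrable fun v => ((zeroCoef γ k α v - M * χ (R⁻¹ • v)) * φ v ^ 2
      - ∑ i, ∑ j, abar γ v i j * (pd i φ v * pd j φ v)) * (jap v ^ α) ^ 2 :=
    integrable_zeroth_sub_dirichlet k α M R hχsm.continuous hχ01 hγ.1 hγ.2 φ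
  have h1 : Integrable fun v => jap v ^ γ * φ v ^ 2 * (jap v ^ α) ^ 2 :=
    integrable_weighted_sq γ α φ
  have h2 : Integrable fun v => jap v ^ γ * ‖anisoGrad φ v‖ ^ 2 * (jap v ^ α) ^ 2 :=
    integrable_weighted_anisoGrad_sq γ α φ
  simp only [hB]
  rw [integral_add hT hU, hT0, zero_add, ← integral_add h1 h2, ← integral_const_mul]
  refine integral_mono hU ((h1.add h2).const_mul _) fun v => ?_
  have hJ := Real.rpow_nonneg (jap_pos v).le γ
  have hW := sq_nonneg (jap v ^ α)
  have hg := hA v (gradient φ v)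
  simp only [gradient_apply] at hg
  rw [mul_assoc, ← norm_anisoGrad_sq] at hg
  have hg' := (mul_le_mul_of_nonneg_right (min_le_left c l)
    (mul_nonneg hJ (sq_nonneg ‖anisoGrad φ v‖))).trans hg
  have hz := mul_le_mul_of_nonneg_right (hZ v) (sq_nonneg (φ v))
  have hz' := mul_le_mul_of_nonneg_right (min_le_right c l) (mul_nonneg hJ (sq_nonneg (φ v)))
  have key := mul_le_mul_of_nonneg_right
    (show (zeroCoef γ k α v - M * χ (R⁻¹ • v)) * φ v ^ 2
      - ∑ i, ∑ j, abar γ v i j * (pd i φ v * pd j φ v)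
      ≤ -min c l * (jap v ^ γ * φ v ^ 2 + jap v ^ γ * ‖anisoGrad φ v‖ ^ 2) by linarith) hW
  refine key.trans (le_of_eq ?_)
  ring
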